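/- arXiv:math/0606716 — 3 statements merged into one kernel-verified Lean document; each statement's English description precedes it below -/
import Mathlib

section
/- Let m, d_L be positive integers. Assume that for every d with d_L ≤ d ≤ d_L + m(m+1) and every p ∈ ℕ the system L_d(m^{×p}) is non-special, and that every system in EoLS(m) is non-special. Then for every d ≥ d_L and every p ∈ ℕ the system L_d(m^{×p}) is non-special. -/
open MvPolynomial

/-- The differential operator `∂^{β₁}_X ∂^{β₂}_Y` on `K[X,Y]` (with `X` the variable `0`
and `Y` the variable `1`). -/
noncomputable def derivOp (K : Type*) [CommRing K] (β : ℕ × ℕ) :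
    Module.End K (MvPolynomial (Fin 2) K) :=
  ((pderiv (0 : Fin 2)).toLinearMap ^ β.1) * ((pderiv (1 : Fin 2)).toLinearMap ^ β.2)

/-- Evaluation of a polynomial in `K[X,Y]` at a point of `K²`, as a linear map. -/
noncomputable def evalPt (K : Type*) [CommRing K] (p : K × K) :
    MvPolynomial (Fin 2) K →ₗ[K] K :=
  (MvPolynomial.aeval (fun i : Fin 2 => if i = 0 then p.1 else p.2)).toLinearMap

/-- The space of polynomials whose monomial support is contained in the diagram `D`. -/
noncomputable def monoSpan (K : Type*) [Field K] (D : Finset (ℕ × ℕ)) :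
    Submodule K (MvPolynomial (Fin 2) K) :=
  Submodule.span K ((fun d : ℕ × ℕ =>
    (monomial (Finsupp.single (0 : Fin 2) d.1 + Finsupp.single 1 d.2) (1 : K))) '' D)

/-- `L_D(m₁p₁, …, m_rp_r)`: the space of polynomials supported on `D` whose partial
derivatives of total order `< m j` all vanish at the point `p j`, for `j = 1, …, r`. -/
noncomputable def linSysPts (K : Type*) [Field K] (D : Finset (ℕ × ℕ)) {r : ℕ}
    (m : Fin r → ℕ) (p : Fin r → K × K) : Submodule K (MvPolynomial (Fin 2) K) :=
  monoSpan K D ⊓ ⨅ j : Fin r, ⨅ β : ℕ × ℕ, ⨅ _ : β.1 + β.2 < m j,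
    LinearMap.ker (evalPt K (p j) ∘ₗ derivOp K β)

/-- `dim L_D(m₁,…,m_r)`: the minimum over all tuples of points of `dim_K L − 1`. -/
noncomputable def dimSys (K : Type*) [Field K] (D : Finset (ℕ × ℕ)) {r : ℕ}
    (m : Fin r → ℕ) : ℤ :=
  sInf (Set.range fun p : Fin r → K × K =>
    (Module.finrank K ↥(linSysPts K D m p) : ℤ) - 1)

/-- The virtual dimension `vdim = #D − 1 − Σ_j C(m_j + 1, 2)`. -/
def vdimSys (D : Finset (ℕ × ℕ)) {r : ℕ} (m : Fin r → ℕ) : ℤ :=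
  (D.card : ℤ) - 1 - ∑ j : Fin r, (((m j + 1).choose 2 : ℕ) : ℤ)

/-- A system is non-special if its dimension equals the expected dimension
`edim = max (vdim, −1)`. -/
def nonSpecial (K : Type*) [Field K] (D : Finset (ℕ × ℕ)) {r : ℕ}
    (m : Fin r → ℕ) : Prop :=
  dimSys K D m = max (vdimSys D m) (-1)

/-- The full diagram of degree `d`: `{α ∈ ℕ² : α₁ + α₂ ≤ d}`, so that
`L_{fullDiagram d} = L_d` is the system of curves of degree at most `d`. -/
def fullDiagram (d : ℕ) : Finset (ℕ × ℕ) :=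
  (Finset.range (d + 1) ×ˢ Finset.range (d + 1)).filter (fun x => x.1 + x.2 ≤ d)

/-- The diagram `(h^{↑k−1}, h^{↑k−2}, …, h^{↑0}, (h−1)^{↑0}, (h−2)^{↑0}, …, 1^{↑0})`:
columns `i = 0, …, k−1` consist of `h` points starting at height `k−1−i`, and columns
`i = k, …, k+h−2` consist of `k+h−1−i` points starting at height `0`.  Explicitly it is
`{(i,j) : i + j ≤ k+h−2 ∧ (k ≤ i ∨ k−1 ≤ i+j)}`. -/
def eolsDiagram (h k : ℕ) : Finset (ℕ × ℕ) :=
  (Finset.range (k + h - 1) ×ˢ Finset.range (k + h - 1)).filter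
    (fun x => x.1 + x.2 ≤ k + h - 2 ∧ (k ≤ x.1 ∨ k - 1 ≤ x.1 + x.2))

namespace EoLS

def tri (n : ℕ) : Finset (ℕ × ℕ) :=
  (Finset.range n ×ˢ Finset.range n).filter (fun x => x.1 + x.2 < n)

lemma mem_tri {n : ℕ} {x : ℕ × ℕ} : x ∈ tri n ↔ x.1 + x.2 < n := by
  simp only [tri, Finset.mem_filter, Finset.mem_product, Finset.mem_range]; omega

lemma full_eq (d : ℕ) : fullDiagram d = tri (d + 1) := by
  ext x
  simp only [fullDiagram, tri, Finset.mem_filter, Finset.mem_product, Finset.mem_range]; omega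

lemma card_tri (n : ℕ) : (tri n).card = (n + 1).choose 2 := by
  induction n with
  | zero => simp [tri]
  | succ n ih =>
    have : tri (n + 1) = tri n ∪ Finset.HasAntidiagonal.antidiagonal n := by
      ext x
      simp only [mem_tri, Finset.mem_union, Finset.HasAntidiagonal.mem_antidiagonal]; omega
    rw [this, Finset.card_union_of_disjoint, ih, Finset.Nat.card_antidiagonal]
    · rw [Nat.choose_succ_succ' (n + 1) 1, Nat.choose_one_right]
      change _ = n + 1 + (n + 1).choose 2
      omega
    · rw [Finset.disjoint_left]
      intro x
      simp only [mem_tri, Finset.HasAntidiagonal.mem_antidiagonal]; omega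

section mats
variable {K : Type*} [Field K] {A ι : Type*}

noncomputable def df (K : Type*) [Field K] (α β : ℕ × ℕ) : K :=
  ((α.1.descFactorial β.1 * α.2.descFactorial β.2 : ℕ) : K)

noncomputable def MA (m : ℕ) (v : A → ℕ × ℕ) (p : ι → K × K) : Matrix (ι × tri m) A K :=
  fun jb a => df K (v a) jb.2 *
    ((p jb.1).1 ^ ((v a).1 - jb.2.1.1) * (p jb.1).2 ^ ((v a).2 - jb.2.1.2))

noncomputable def MT (m : ℕ) (v : A → ℕ × ℕ) (p : ι → K × K) : Matrix (ι × tri m) A K :=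
  fun jb a => df K (v a) jb.2 * ((p jb.1).1 ^ (v a).1 * (p jb.1).2 ^ (v a).2)

noncomputable def kd {I : Type*} [Fintype A] (M : Matrix I A K) : ℕ :=
  Module.finrank K (LinearMap.ker M.mulVecLin)

lemma df_mul (α β : ℕ × ℕ) (x y : K) :
    df K α β * (x ^ α.1 * y ^ α.2) =
      (x ^ β.1 * y ^ β.2) * (df K α β * (x ^ (α.1 - β.1) * y ^ (α.2 - β.2))) := by
  by_cases h1 : α.1 < β.1
  · simp [df, Nat.descFactorial_of_lt h1]
  by_cases h2 : α.2 < β.2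
  · simp [df, Nat.descFactorial_of_lt h2]
  have e1 : x ^ α.1 = x ^ β.1 * x ^ (α.1 - β.1) := by rw [← pow_add]; congr 1; omega
  have e2 : y ^ α.2 = y ^ β.2 * y ^ (α.2 - β.2) := by rw [← pow_add]; congr 1; omega
  rw [e1, e2]; ring

lemma kd_MT_eq [Fintype A] (m : ℕ) (v : A → ℕ × ℕ) (p : ι → K × K)
    (hp : ∀ j, (p j).1 ≠ 0 ∧ (p j).2 ≠ 0) : kd (MT m v p) = kd (MA m v p) := by
  unfold kd
  have : LinearMap.ker (MT m v p).mulVecLin = LinearMap.ker (MA m v p).mulVecLin := by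
    ext c
    simp only [LinearMap.mem_ker, Matrix.mulVecLin_apply, funext_iff]
    refine forall_congr' fun jb => ?_
    have : (MT m v p).mulVec c jb =
        ((p jb.1).1 ^ jb.2.1.1 * (p jb.1).2 ^ jb.2.1.2) * (MA m v p).mulVec c jb := by
      simp only [Matrix.mulVec, dotProduct, Finset.mul_sum, MT, MA]
      refine Finset.sum_congr rfl fun a _ => ?_
      rw [df_mul]; ring
    rw [this]
    have h := hp jb.1
    simp [h.1, h.2]
  rw [this]

lemma pd_iter (i : Fin 2) (k : ℕ) (s : Fin 2 →₀ ℕ) (a : K) :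
    ((pderiv i).toLinearMap ^ k : Module.End K (MvPolynomial (Fin 2) K)) (monomial s a) =
      monomial (s - Finsupp.single i k) (a * ((s i).descFactorial k : ℕ)) := by
  induction k with
  | zero => simp
  | succ k ih =>
    rw [pow_succ', Module.End.mul_apply, ih]
    rw [show ∀ q, (pderiv i).toLinearMap q = pderiv (R := K) i q from fun _ => rfl,
      pderiv_monomial]
    refine congrArg₂ (fun s a => monomial s a) ?_ ?_
    · ext j
      simp only [Finsupp.coe_tsub, Pi.sub_apply]
      by_cases h : i = j
      · subst h; simp; omega
      · simp [Finsupp.single_apply, h]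
    · simp [Nat.descFactorial_succ]; ring

lemma eval_deriv (α β : ℕ × ℕ) (p : K × K) :
    evalPt K p (derivOp K β
      (monomial (Finsupp.single (0 : Fin 2) α.1 + Finsupp.single 1 α.2) (1 : K))) =
    df K α β * (p.1 ^ (α.1 - β.1) * p.2 ^ (α.2 - β.2)) := by
  unfold derivOp evalPt
  rw [Module.End.mul_apply, pd_iter, pd_iter]
  simp only [AlgHom.toLinearMap_apply, aeval_monomial, df]
  rw [Finsupp.prod_fintype _ _ (by simp)]
  simp [Fin.prod_univ_two, Finsupp.single_apply, mul_comm]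

noncomputable def Phi (K : Type*) [Field K] (D : Finset (ℕ × ℕ)) :
    (D → K) →ₗ[K] MvPolynomial (Fin 2) K :=
  Fintype.linearCombination K (fun d : D =>
    (monomial (Finsupp.single (0 : Fin 2) d.1.1 + Finsupp.single 1 d.1.2) (1 : K)))

lemma Phi_inj (D : Finset (ℕ × ℕ)) : Function.Injective (Phi K D) := by
  have h : LinearIndependent K (fun d : D =>
    (monomial (Finsupp.single (0 : Fin 2) d.1.1 + Finsupp.single 1 d.1.2) (1 : K))) := by
    have := (MvPolynomial.basisMonomials (Fin 2) K).linearIndependent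
    have h2 := this.comp (fun d : D =>
      (Finsupp.single (0 : Fin 2) d.1.1 + Finsupp.single 1 d.1.2)) (by
        intro a b hab
        have h0 := DFunLike.congr_fun hab 0
        have h1 := DFunLike.congr_fun hab 1
        simp at h0 h1
        exact Subtype.ext (Prod.ext h0 h1))
    simpa [Function.comp_def] using h2
  exact LinearIndependent.fintypeLinearCombination_injective h

lemma Phi_range (D : Finset (ℕ × ℕ)) : LinearMap.range (Phi K D) = monoSpan K D := by
  unfold Phi monoSpan
  rw [Fintype.range_linearCombination, Set.image_eq_range]
  rfl

lemma finrank_linSys (D : Finset (ℕ × ℕ)) (m : ℕ) {r : ℕ} (p : Fin r → K × K) :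
    Module.finrank K (linSysPts K D (fun _ => m) p) =
      kd (MA m (Subtype.val : D → ℕ × ℕ) p) := by
  have key : ∀ (c : D → K) (j : Fin r) (β : ℕ × ℕ) (hβ : β ∈ tri m),
      evalPt K (p j) (derivOp K β (Phi K D c)) =
        (MA m (Subtype.val : D → ℕ × ℕ) p).mulVec c (j, ⟨β, hβ⟩) := by
    intro c j β hβ
    simp only [Phi, Fintype.linearCombination_apply, map_sum, map_smul, eval_deriv,
      Matrix.mulVec, dotProduct, MA, smul_eq_mul]
    exact Finset.sum_congr rfl fun a _ => mul_comm _ _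
  have : linSysPts K D (fun _ => m) p =
      (LinearMap.ker (MA m (Subtype.val : D → ℕ × ℕ) p).mulVecLin).map (Phi K D) := by
    ext f
    simp only [linSysPts, Submodule.mem_inf, ← Phi_range, Submodule.mem_iInf, LinearMap.mem_ker,
      LinearMap.comp_apply, Submodule.mem_map, LinearMap.mem_range, Matrix.mulVecLin_apply]
    constructor
    · rintro ⟨⟨c, rfl⟩, h⟩
      refine ⟨c, ?_, rfl⟩
      ext ⟨j, β, hβ⟩
      rw [← key]
      exact h j β (mem_tri.1 hβ)
    · rintro ⟨c, hc, rfl⟩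
      refine ⟨⟨c, rfl⟩, fun j β hβ => ?_⟩
      rw [key c j β (mem_tri.2 hβ), hc]; rfl
  rw [this, kd]
  exact (LinearEquiv.finrank_eq (Submodule.equivMapOfInjective _ (Phi_inj D) _)).symm

end mats
end EoLS
namespace EoLS
section semi
variable {K : Type*} [Field K] {A I J : Type*} [Fintype A]

lemma kd_add_rank (M : Matrix I A K) : M.rank + kd M = Fintype.card A := by
  rw [Matrix.rank, kd, LinearMap.finrank_range_add_finrank_ker, Module.finrank_fintype_fun_eq_card]

lemma kd_lower [Fintype I] (M : Matrix I A K) : Fintype.card A ≤ kd M + Fintype.card I := by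
  have := kd_add_rank M
  have := M.rank_le_card_height
  omega

lemma exists_LV [Fintype I] [DecidableEq I] (M : Matrix I A K) :
    ∃ (ρ : ℕ) (L : Matrix (Fin ρ) I K) (V : Matrix A (Fin ρ) K),
      ρ = M.rank ∧ L * M * V = 1 := by
  classical
  let f := M.mulVecLin
  let R := LinearMap.range f
  let b := Module.finBasis K R
  have hs : ∀ i, ∃ v, f v = (b i : I → K) := fun i => (b i).2
  choose v hv using hs
  obtain ⟨φ, hφ⟩ := (R.subtype).exists_leftInverse_of_injective (by simp)
  let g : (I → K) →ₗ[K] (Fin (Module.finrank K R) → K) := b.equivFun.toLinearMap ∘ₗ φ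
  refine ⟨Module.finrank K R, LinearMap.toMatrix' g, Matrix.of fun a j => v j a, rfl, ?_⟩
  ext i j
  have h1 : (LinearMap.toMatrix' g * M * Matrix.of fun a j => v j a) i j =
      (g (f (v j))) i := by
    rw [Matrix.mul_assoc, ← LinearMap.toMatrix'_mulVec g]
    rfl
  rw [h1, hv]
  have h2 : φ (b j) = b j := by
    have := LinearMap.congr_fun hφ (b j)
    simpa using this
  simp only [g, LinearMap.comp_apply, h2]
  simp [Matrix.one_apply, Finsupp.single_apply, eq_comm]

open Polynomial in
lemma semi [Fintype I] [Infinite K] (T : Matrix I A K[X]) (S : Finset K) :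
    ∃ u, u ∉ S ∧ kd (T.map (Polynomial.eval u)) ≤ kd (T.map (Polynomial.eval 0)) := by
  classical
  obtain ⟨ρ, L, V, hρ, h⟩ := exists_LV (T.map (Polynomial.eval 0))
  let P : K[X] := (L.map Polynomial.C * T * V.map Polynomial.C).det
  have hP : ∀ u, P.eval u = (L * T.map (Polynomial.eval u) * V).det := by
    intro u
    have := RingHom.map_det (Polynomial.evalRingHom u) (L.map Polynomial.C * T * V.map Polynomial.C)
    rw [← Polynomial.coe_evalRingHom, this]
    congr 1
    rw [RingHom.mapMatrix_apply, Matrix.map_mul, Matrix.map_mul]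
    congr 2 <;> · ext; simp
  have h0 : P ≠ 0 := by
    intro h0
    have := hP 0
    rw [h, h0] at this
    simp at this
  obtain ⟨u, hu⟩ := Infinite.exists_notMem_finset (S ∪ P.roots.toFinset)
  rw [Finset.mem_union, not_or] at hu
  refine ⟨u, hu.1, ?_⟩
  have hne : P.eval u ≠ 0 := by
    intro h1
    apply hu.2
    simp [h0, h1]
  rw [hP] at hne
  have hr := Matrix.rank_of_isUnit _ ((Matrix.isUnit_iff_isUnit_det _).2 (isUnit_iff_ne_zero.2 hne))
  have h1 := Matrix.rank_mul_le_left (L * T.map (Polynomial.eval u)) V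
  have h2 := Matrix.rank_mul_le_right L (T.map (Polynomial.eval u))
  have h3 := kd_add_rank (T.map (Polynomial.eval u))
  have h4 := kd_add_rank (T.map (Polynomial.eval 0))
  rw [Fintype.card_fin] at hr
  omega

end semi

section cut
variable {K : Type*} [Field K] {A A' ι κ : Type*} [Fintype A] [Fintype A']

set_option linter.unusedSectionVars false

lemma mem_ker_MT {m : ℕ} {v : A → ℕ × ℕ} {p : ι → K × K} {c : A → K} :
    c ∈ LinearMap.ker (MT m v p).mulVecLin ↔
      ∀ j, ∀ β ∈ tri m, ∑ a, df K (v a) β * ((p j).1 ^ (v a).1 * (p j).2 ^ (v a).2) * c a = 0 := by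
  simp only [LinearMap.mem_ker, Matrix.mulVecLin_apply, funext_iff]
  exact ⟨fun h j β hβ => h (j, ⟨β, hβ⟩), fun h jb => h jb.1 jb.2.1 jb.2.2⟩

lemma ker_MT_comp_pts (m : ℕ) (v : A → ℕ × ℕ) (p : ι → K × K) (e : κ ≃ ι) :
    LinearMap.ker (MT m v (p ∘ e)).mulVecLin = LinearMap.ker (MT m v p).mulVecLin := by
  ext c
  rw [mem_ker_MT, mem_ker_MT]
  exact ⟨fun h j => by simpa using h (e.symm j), fun h j => h (e j)⟩

lemma kd_comp_pts (m : ℕ) (v : A → ℕ × ℕ) (p : ι → K × K) (e : κ ≃ ι) :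
    kd (MT m v (p ∘ e)) = kd (MT m v p) := by
  unfold kd; rw [ker_MT_comp_pts]

lemma kd_comp_cols_le (m : ℕ) (v : A → ℕ × ℕ) (p : ι → K × K) (e : A' ≃ A) :
    kd (MT m (v ∘ e) p) = kd (MT m v p) := by
  have h : LinearMap.ker (MT m (v ∘ e) p).mulVecLin =
      (LinearMap.ker (MT m v p).mulVecLin).map (LinearEquiv.funCongrLeft K K e).toLinearMap := by
    ext c
    rw [Submodule.mem_map]
    constructor
    · intro hc
      refine ⟨c ∘ e.symm, ?_, by ext; simp [LinearEquiv.funCongrLeft]⟩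
      rw [mem_ker_MT] at hc ⊢
      intro j β hβ
      rw [← hc j β hβ, ← e.sum_comp]
      simp
    · rintro ⟨c, hc, rfl⟩
      rw [mem_ker_MT] at hc ⊢
      intro j β hβ
      rw [← hc j β hβ, ← e.sum_comp]
      simp [LinearEquiv.funCongrLeft]
  unfold kd
  rw [h]
  exact LinearEquiv.finrank_map_eq _ _

/-- dropping points -/
lemma kd_drop [Fintype κ] (m : ℕ) (v : A → ℕ × ℕ) (p : ι → K × K) (q : κ → K × K) :
    kd (MT m v p) ≤ kd (MT m v (Sum.elim p q)) + Fintype.card κ * (tri m).card := by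
  have h : LinearMap.ker (MT m v (Sum.elim p q)).mulVecLin =
      LinearMap.ker (MT m v p).mulVecLin ⊓ LinearMap.ker (MT m v q).mulVecLin := by
    ext c
    rw [Submodule.mem_inf, mem_ker_MT, mem_ker_MT, mem_ker_MT]
    simp
  have h1 := Submodule.finrank_sup_add_finrank_inf_eq (LinearMap.ker (MT m v p).mulVecLin)
    (LinearMap.ker (MT m v q).mulVecLin)
  have h2 := Submodule.finrank_le (LinearMap.ker (MT m v p).mulVecLin ⊔
    LinearMap.ker (MT m v q).mulVecLin)
  have h3 := kd_lower (MT m v q)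
  rw [Fintype.card_prod, Fintype.card_coe] at h3
  rw [Module.finrank_fintype_fun_eq_card] at h2
  unfold kd at *
  rw [h]
  omega

/-- generic position -/
lemma kd_generic [Fintype ι] [Infinite K] (m : ℕ) (v : A → ℕ × ℕ) (p : ι → K × K) :
    ∃ p' : ι → K × K, (∀ j, (p' j).1 ≠ 0 ∧ (p' j).2 ≠ 0) ∧ kd (MA m v p') ≤ kd (MA m v p) := by
  classical
  let T : Matrix (ι × tri m) A (Polynomial K) := fun jb a => Polynomial.C (df K (v a) jb.2) *
    ((Polynomial.C (p jb.1).1 + Polynomial.X) ^ ((v a).1 - jb.2.1.1) *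
      (Polynomial.C (p jb.1).2 + Polynomial.X) ^ ((v a).2 - jb.2.1.2))
  obtain ⟨u, hu, h⟩ := semi T (Finset.univ.image (fun j => -(p j).1) ∪
    Finset.univ.image (fun j => -(p j).2))
  have hT : ∀ u, T.map (Polynomial.eval u) = MA m v (fun j => ((p j).1 + u, (p j).2 + u)) := by
    intro u; ext jb a; rw [Matrix.map_apply]; simp [T, MA]
  rw [hT, hT] at h
  refine ⟨_, fun j => ⟨fun h0 => hu ?_, fun h0 => hu ?_⟩, h.trans (le_of_eq (by simp))⟩
  · refine Finset.mem_union_left _ (Finset.mem_image.2 ⟨j, Finset.mem_univ _, ?_⟩)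
    simp only at h0
    linear_combination -h0
  · refine Finset.mem_union_right _ (Finset.mem_image.2 ⟨j, Finset.mem_univ _, ?_⟩)
    simp only at h0
    linear_combination -h0

lemma MT_scale {A : Type*} (m : ℕ) (v : A → ℕ × ℕ) (q : κ → K × K) (x y : ℤ) {s : K} (hs : s ≠ 0)
    (i : κ × tri m) (a : A) :
    MT m v (fun j => (s ^ x * (q j).1, s ^ y * (q j).2)) i a =
      MT m v q i a * s ^ (x * (v a).1 + y * (v a).2) := by
  simp only [MT, zpow_add₀ hs, zpow_mul, zpow_natCast, mul_pow]
  ring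

/-- the cutting lemma -/
lemma cut [Fintype ι] [Finite κ] [Infinite K] (m : ℕ) (v : A → ℕ × ℕ) (v' : A' → ℕ × ℕ)
    (p : ι → K × K) (q : κ → K × K) (hq : ∀ j, (q j).1 ≠ 0 ∧ (q j).2 ≠ 0)
    (x y : ℤ) (hw : ∀ a b, x * (v' b).1 + y * (v' b).2 < x * (v a).1 + y * (v a).2)
    (h0 : kd (MT m v' q) = 0) :
    ∃ q' : κ → K × K, (∀ j, (q' j).1 ≠ 0 ∧ (q' j).2 ≠ 0) ∧
      kd (MT m (Sum.elim v v') (Sum.elim p q')) ≤ kd (MT m v p) := by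
  classical
  have := Fintype.ofFinite κ
  let w : ℕ × ℕ → ℤ := fun α => x * α.1 + y * α.2
  have hker : LinearMap.ker (MT m v' q).mulVecLin = ⊥ := Submodule.finrank_eq_zero.mp h0
  obtain ⟨L, hL⟩ := (MT m v' q).mulVecLin.exists_leftInverse_of_injective hker
  let N : Matrix A' A K := LinearMap.toMatrix' (-(L ∘ₗ (MT m v q).mulVecLin))
  let T : Matrix (ι × tri m) A (Polynomial K) := fun i a =>
    Polynomial.C (MT m v p i a) + ∑ b, Polynomial.C (MT m v' p i b * N b a) *
      Polynomial.X ^ (w (v a) - w (v' b)).toNat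
  obtain ⟨s, hs, h⟩ := semi T {0}
  have hs : s ≠ 0 := by simpa using hs
  have hT0 : T.map (Polynomial.eval 0) = MT m v p := by
    ext i a
    rw [Matrix.map_apply]
    simp only [T, Polynomial.eval_add, Polynomial.eval_C,
      Polynomial.eval_finsetSum, Polynomial.eval_mul, Polynomial.eval_pow, Polynomial.eval_X]
    rw [Finset.sum_eq_zero, add_zero]
    intro b _
    have := hw a b
    rw [zero_pow (by simp only [w]; omega), mul_zero]
  have hTs : ∀ i a, T.map (Polynomial.eval s) i a =
      MT m v p i a + ∑ b, MT m v' p i b * N b a * (s ^ w (v a) * (s ^ w (v' b))⁻¹) := by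
    intro i a
    rw [Matrix.map_apply]
    simp only [T, Polynomial.eval_add, Polynomial.eval_C,
      Polynomial.eval_finsetSum, Polynomial.eval_mul, Polynomial.eval_pow, Polynomial.eval_X]
    congr 1
    refine Finset.sum_congr rfl fun b _ => ?_
    rw [← zpow_natCast, Int.toNat_of_nonneg (by have := hw a b; simp only [w]; omega),
      zpow_sub₀ hs, div_eq_mul_inv]
  rw [hT0] at h
  let q' : κ → K × K := fun j => (s ^ x * (q j).1, s ^ y * (q j).2)
  refine ⟨q', fun j => ⟨mul_ne_zero (zpow_ne_zero _ hs) (hq j).1,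
    mul_ne_zero (zpow_ne_zero _ hs) (hq j).2⟩, le_trans ?_ h⟩
  -- injection of kernels
  have main : ∀ c ∈ LinearMap.ker (MT m (Sum.elim v v') (Sum.elim p q')).mulVecLin,
      (∀ b, c (Sum.inr b) = (s ^ w (v' b))⁻¹ * ∑ a, N b a * (s ^ w (v a) * c (Sum.inl a))) ∧
      (c ∘ Sum.inl) ∈ LinearMap.ker (T.map (Polynomial.eval s)).mulVecLin := by
    intro c hc
    rw [mem_ker_MT] at hc
    have e2 : (MT m v q).mulVecLin (fun a => s ^ w (v a) * c (Sum.inl a)) +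
        (MT m v' q).mulVecLin (fun b => s ^ w (v' b) * c (Sum.inr b)) = 0 := by
      ext jb
      have := hc (Sum.inr jb.1) jb.2.1 jb.2.2
      rw [Fintype.sum_sum_type] at this
      refine Eq.trans ?_ this
      simp only [Pi.add_apply, Matrix.mulVecLin_apply, Matrix.mulVec, dotProduct]
      congr 1
      · refine Finset.sum_congr rfl fun a _ => ?_
        have := MT_scale m v q x y hs jb a
        rw [← mul_assoc, ← this]; rfl
      · refine Finset.sum_congr rfl fun a _ => ?_
        have := MT_scale m v' q x y hs jb a
        rw [← mul_assoc, ← this]; rfl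
    have e3 : ∀ b, s ^ w (v' b) * c (Sum.inr b) = ∑ a, N b a * (s ^ w (v a) * c (Sum.inl a)) := by
      intro b
      have h1 := congrArg L e2
      rw [map_add, map_zero] at h1
      have h2 := LinearMap.congr_fun hL (fun b => s ^ w (v' b) * c (Sum.inr b))
      simp only [LinearMap.comp_apply, LinearMap.id_apply] at h2
      rw [h2] at h1
      have h3 := LinearMap.toMatrix'_mulVec (-(L ∘ₗ (MT m v q).mulVecLin))
        (fun a => s ^ w (v a) * c (Sum.inl a))
      have h4 := congrFun h3 b
      have h5 := congrFun h1 b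
      simp only [Pi.add_apply, Pi.zero_apply, LinearMap.neg_apply, Pi.neg_apply,
        LinearMap.comp_apply] at h4 h5
      rw [eq_neg_of_add_eq_zero_right h5, ← h4]
      rfl
    have e4 : ∀ b, c (Sum.inr b) = (s ^ w (v' b))⁻¹ * ∑ a, N b a * (s ^ w (v a) * c (Sum.inl a)) := by
      intro b
      rw [← e3, inv_mul_cancel_left₀ (zpow_ne_zero _ hs)]
    refine ⟨e4, ?_⟩
    rw [LinearMap.mem_ker]
    ext jb
    have := hc (Sum.inl jb.1) jb.2.1 jb.2.2
    rw [Fintype.sum_sum_type] at this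
    refine Eq.trans ?_ this
    simp only [Matrix.mulVecLin_apply, Matrix.mulVec, dotProduct, hTs, add_mul,
      Finset.sum_add_distrib]
    congr 1
    simp only [Finset.sum_mul]
    rw [Finset.sum_comm]
    refine Finset.sum_congr rfl fun b _ => ?_
    rw [e4, Finset.mul_sum, Finset.mul_sum]
    refine Finset.sum_congr rfl fun a _ => ?_
    simp only [MT, Function.comp, Sum.elim_inl, Sum.elim_inr]
    ring
  let F : LinearMap.ker (MT m (Sum.elim v v') (Sum.elim p q')).mulVecLin →ₗ[K]
      LinearMap.ker (T.map (Polynomial.eval s)).mulVecLin :=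
    ((LinearMap.funLeft K K (Sum.inl : A → A ⊕ A')).restrict (fun c hc => (main c hc).2))
  refine LinearMap.finrank_le_finrank_of_injective (f := F) ?_
  rw [← LinearMap.ker_eq_bot, LinearMap.ker_eq_bot']
  rintro ⟨c, hc⟩ h
  have hl : ∀ a, c (Sum.inl a) = 0 := fun a => congrFun (congrArg Subtype.val h) a
  ext i
  rcases i with a | b
  · exact hl a
  · have := (main c hc).1 b
    simp only [hl] at this
    simpa using this

end cut
end EoLS
namespace EoLS
section good
variable {K : Type*} [Field K]

def nz {ι : Type*} (p : ι → K × K) : Prop := ∀ j, (p j).1 ≠ 0 ∧ (p j).2 ≠ 0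

noncomputable def kD {ι : Type*} (m : ℕ) (D : Finset (ℕ × ℕ)) (p : ι → K × K) : ℕ :=
  kd (MT m (Subtype.val : D → ℕ × ℕ) p)

def Good (K : Type*) [Field K] (m : ℕ) (D : Finset (ℕ × ℕ)) (r : ℕ) : Prop :=
  D.card = r * (tri m).card ∧ ∃ p : Fin r → K × K, nz p ∧ kD m D p = 0

lemma cutD [Infinite K] {m : ℕ} {D₁ D₂ : Finset (ℕ × ℕ)} {r s : ℕ} (p : Fin r → K × K) (hp : nz p)
    (h : Good K m D₂ s) (x y : ℤ)
    (hw : ∀ a ∈ D₁, ∀ b ∈ D₂, x * b.1 + y * b.2 < x * a.1 + y * a.2) :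
    D₁.card + D₂.card = (D₁ ∪ D₂).card ∧
    ∃ P : Fin (r + s) → K × K, nz P ∧ kD m (D₁ ∪ D₂) P ≤ kD m D₁ p := by
  have hd : Disjoint D₁ D₂ := by
    rw [Finset.disjoint_left]
    intro a h1 h2
    exact lt_irrefl _ (hw a h1 a h2)
  refine ⟨(Finset.card_union_of_disjoint hd).symm, ?_⟩
  obtain ⟨-, q, hq, h0⟩ := h
  obtain ⟨q', hq', hk⟩ := cut m (Subtype.val : D₁ → ℕ × ℕ) (Subtype.val : D₂ → ℕ × ℕ) p q hq x y
    (fun a b => hw a a.2 b b.2) h0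
  refine ⟨Sum.elim p q' ∘ finSumFinEquiv.symm, fun j => ?_, le_trans (le_of_eq ?_) hk⟩
  · rcases hj : finSumFinEquiv.symm j with i | i
    · simpa [hj] using hp i
    · simpa [hj] using hq' i
  · unfold kD
    rw [kd_comp_pts, ← kd_comp_cols_le _ _ _ (Equiv.Finset.union D₁ D₂ hd)]
    congr 2
    ext a : 1
    rcases a with a | a <;> simp

lemma Good.union [Infinite K] {m : ℕ} {D₁ D₂ : Finset (ℕ × ℕ)} {r s : ℕ} (h₁ : Good K m D₁ r)
    (h : Good K m D₂ s) (x y : ℤ)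
    (hw : ∀ a ∈ D₁, ∀ b ∈ D₂, x * b.1 + y * b.2 < x * a.1 + y * a.2) :
    Good K m (D₁ ∪ D₂) (r + s) := by
  obtain ⟨hc, p, hp, h0⟩ := h₁
  obtain ⟨hu, P, hP, hk⟩ := cutD p hp h x y hw
  exact ⟨by rw [← hu, hc, h.1, add_mul], P, hP, by omega⟩

lemma Good.empty (m : ℕ) : Good K m ∅ 0 := by
  refine ⟨by simp, Fin.elim0, fun j => j.elim0, ?_⟩
  have := kd_add_rank (MT m (Subtype.val : (∅ : Finset (ℕ × ℕ)) → ℕ × ℕ) (Fin.elim0 : Fin 0 → K × K))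
  simp at this
  exact this.2

lemma ns_iff [CharZero K] (m : ℕ) (D : Finset (ℕ × ℕ)) (r : ℕ) :
    nonSpecial K D (fun _ : Fin r => m) ↔
      ∃ p : Fin r → K × K, nz p ∧ kD m D p ≤ D.card - r * (tri m).card := by
  have hv : vdimSys D (fun _ : Fin r => m) = (D.card : ℤ) - 1 - r * (tri m).card := by
    simp [vdimSys, card_tri]
  have hlow : ∀ p : Fin r → K × K,
      D.card ≤ kd (MA m (Subtype.val : D → ℕ × ℕ) p) + r * (tri m).card := by
    intro p
    have := kd_lower (MA m (Subtype.val : D → ℕ × ℕ) p)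
    simpa [Fintype.card_prod] using this
  have hb : BddBelow (Set.range fun p : Fin r → K × K =>
    (Module.finrank K ↥(linSysPts K D (fun _ : Fin r => m) p) : ℤ) - 1) := by
    refine ⟨-1, ?_⟩
    rintro _ ⟨p, rfl⟩
    simp only
    omega
  have hcast : ((r * (tri m).card : ℕ) : ℤ) = r * (tri m).card := by push_cast; rfl
  unfold nonSpecial
  rw [hv, ← hcast]
  constructor
  · intro h
    obtain ⟨p, hp⟩ := Int.csInf_mem (Set.range_nonempty _) hb
    change _ = dimSys K D _ at hp
    rw [h] at hp
    simp only [finrank_linSys] at hp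
    obtain ⟨p', hp', hk⟩ := kd_generic m (Subtype.val : D → ℕ × ℕ) p
    refine ⟨p', hp', ?_⟩
    unfold kD
    rw [kd_MT_eq _ _ _ hp']
    omega
  · rintro ⟨p, hp, hk⟩
    unfold kD at hk
    rw [kd_MT_eq _ _ _ hp] at hk
    apply le_antisymm
    · refine le_trans (csInf_le hb ⟨p, rfl⟩) ?_
      simp only [finrank_linSys]
      omega
    · refine le_csInf (Set.range_nonempty _) ?_
      rintro _ ⟨p, rfl⟩
      simp only [finrank_linSys]
      have := hlow p
      omega

open Polynomial in
lemma functional_zero (Λ : K[X] →ₗ[K] K) (n : ℕ)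
    (h : ∀ k ≤ n, Λ (descPochhammer K k) = 0) (f : K[X]) (hf : f.natDegree ≤ n) : Λ f = 0 := by
  induction n generalizing f with
  | zero =>
    rw [Polynomial.eq_C_of_natDegree_le_zero hf]
    have := h 0 le_rfl
    rw [descPochhammer_zero] at this
    rw [← mul_one (Polynomial.C _), ← Polynomial.smul_eq_C_mul, map_smul, this, smul_zero]
  | succ n ih =>
    have h1 := ih (fun k hk => h k (by omega))
      (f - Polynomial.C (f.coeff (n + 1)) * descPochhammer K (n + 1)) (by
        rw [Polynomial.natDegree_le_iff_coeff_eq_zero]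
        intro N hN
        rw [Polynomial.coeff_sub, Polynomial.coeff_C_mul]
        have hmon := monic_descPochhammer K (n + 1)
        have hdeg := descPochhammer_natDegree K (n + 1)
        rcases Nat.lt_or_ge (n + 1) N with h2 | h2
        · rw [Polynomial.coeff_eq_zero_of_natDegree_lt (by omega),
            Polynomial.coeff_eq_zero_of_natDegree_lt (p := descPochhammer K (n + 1)) (by omega)]
          simp
        · obtain rfl : N = n + 1 := by omega
          have : (descPochhammer K (n + 1)).coeff (n + 1) = 1 := by
            have := hmon.coeff_natDegree
            rwa [hdeg] at this
          rw [this]; ring)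
    rw [map_sub, ← Polynomial.smul_eq_C_mul, map_smul, h (n + 1) le_rfl] at h1
    simpa using h1

lemma df_eq (α β : ℕ × ℕ) : df K α β =
    (descPochhammer K β.1).eval (α.1 : K) * (descPochhammer K β.2).eval (α.2 : K) := by
  rw [descPochhammer_eval_eq_descFactorial, descPochhammer_eval_eq_descFactorial, df]
  push_cast; rfl

open Polynomial in
/-- integrate against `f(a₁) g(a₂)` weight -/
noncomputable def evl {A : Type*} [Fintype A] (z : A → K) (W : A → K) : K[X] →ₗ[K] K :=
  ∑ a, (W a) • Polynomial.leval (z a)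

lemma evl_apply {A : Type*} [Fintype A] (z : A → K) (W : A → K) (f : Polynomial K) :
    evl z W f = ∑ a, W a * f.eval (z a) := by
  simp [evl, Polynomial.leval_apply, LinearMap.sum_apply]

open Polynomial in
lemma ker_iff {A ι : Type*} [Fintype A] {m : ℕ} {v : A → ℕ × ℕ} {p : ι → K × K} {c : A → K} :
    c ∈ LinearMap.ker (MT m v p).mulVecLin ↔
      ∀ j, ∀ f g : K[X], f.natDegree + g.natDegree < m →
        ∑ a, f.eval ((v a).1 : K) * g.eval ((v a).2 : K) *
          ((p j).1 ^ (v a).1 * (p j).2 ^ (v a).2) * c a = 0 := by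
  rw [mem_ker_MT]
  constructor
  · intro h j f g hfg
    have h1 : ∀ b, f.natDegree + b < m → ∑ a, f.eval ((v a).1 : K) *
        (descPochhammer K b).eval ((v a).2 : K) *
          ((p j).1 ^ (v a).1 * (p j).2 ^ (v a).2) * c a = 0 := by
      intro b hb
      have := functional_zero (evl (fun a => ((v a).1 : K)) (fun a =>
        (descPochhammer K b).eval ((v a).2 : K) *
          ((p j).1 ^ (v a).1 * (p j).2 ^ (v a).2) * c a)) f.natDegree (by
          intro k hk
          rw [evl_apply, ← h j (k, b) (mem_tri.2 (by simp only; omega))]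
          refine Finset.sum_congr rfl fun a _ => ?_
          rw [df_eq]; ring) f le_rfl
      rw [evl_apply] at this
      rw [← this]
      refine Finset.sum_congr rfl fun a _ => ?_
      ring
    have := functional_zero (evl (fun a => ((v a).2 : K)) (fun a =>
      f.eval ((v a).1 : K) * ((p j).1 ^ (v a).1 * (p j).2 ^ (v a).2) * c a)) g.natDegree (by
        intro k hk
        rw [evl_apply, ← h1 k (by omega)]
        refine Finset.sum_congr rfl fun a _ => ?_
        ring) g le_rfl
    rw [evl_apply] at this
    rw [← this]
    refine Finset.sum_congr rfl fun a _ => ?_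
    ring
  · intro h j β hβ
    rw [mem_tri] at hβ
    simp only [df_eq]
    exact h j _ _ (by rw [descPochhammer_natDegree, descPochhammer_natDegree]; exact hβ)

open Polynomial in
lemma Good.shift {m : ℕ} {D : Finset (ℕ × ℕ)} {r : ℕ} (h : Good K m D r) (t : ℕ)
    (D' : Finset (ℕ × ℕ)) (hD : ∀ x, x ∈ D' ↔ ∃ y ∈ D, x = (y.1 + t, y.2)) : Good K m D' r := by
  obtain ⟨hc, p, hp, h0⟩ := h
  let e : D ≃ D' := Equiv.ofBijective
    (fun y => ⟨(y.1.1 + t, y.1.2), (hD _).2 ⟨y.1, y.2, rfl⟩⟩) (by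
      constructor
      · intro a b hab
        simp only [Subtype.mk.injEq, Prod.mk.injEq] at hab
        exact Subtype.ext (Prod.ext (by omega) (by omega))
      · rintro ⟨x, hx⟩
        obtain ⟨y, hy, rfl⟩ := (hD x).1 hx
        exact ⟨⟨y, hy⟩, rfl⟩)
  refine ⟨?_, p, hp, ?_⟩
  · rw [← hc]
    have := Fintype.card_congr e
    simpa using this.symm
  · unfold kD at h0 ⊢
    rw [← kd_comp_cols_le _ _ _ e]
    unfold kd at h0 ⊢
    rw [Submodule.finrank_eq_zero] at h0 ⊢
    rw [eq_bot_iff] at h0 ⊢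
    intro c hcc
    apply h0
    rw [ker_iff] at hcc ⊢
    intro j f g hfg
    have := hcc j (f.comp (Polynomial.X - Polynomial.C (t : K))) g (by
      rw [Polynomial.natDegree_comp, Polynomial.natDegree_X_sub_C, mul_one]; exact hfg)
    have h2 : (p j).1 ^ t * ∑ a : D, f.eval (a.1.1 : K) * g.eval (a.1.2 : K) *
          ((p j).1 ^ a.1.1 * (p j).2 ^ a.1.2) * c a = 0 := by
      rw [← this, Finset.mul_sum]
      refine Finset.sum_congr rfl fun a _ => ?_
      have he : (Subtype.val ∘ e) a = (a.1.1 + t, a.1.2) := rfl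
      rw [he]
      simp [pow_add]
      ring
    exact (mul_eq_zero.1 h2).resolve_left (pow_ne_zero _ (hp j).1)

open Polynomial in
lemma Good.single [CharZero K] {m : ℕ} {D : Finset (ℕ × ℕ)} (hc : D.card = (tri m).card) (σ : ℕ → ℕ)
    (hinj : ∀ a ∈ D, ∀ b ∈ D, σ a.1 = σ b.1 → a.1 = b.1) (hm : ∀ a ∈ D, σ a.1 ≤ m)
    (hcol : ∀ a ∈ D, (D.filter (fun b => b.1 = a.1)).card ≤ σ a.1) : Good K m D 1 := by
  classical
  refine ⟨by omega, fun _ => (1, 1), fun _ => by simp, ?_⟩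
  unfold kD kd
  rw [Submodule.finrank_eq_zero, eq_bot_iff]
  intro c hcc
  rw [ker_iff] at hcc
  have hcc := hcc 0
  simp only [one_pow, mul_one] at hcc
  have main : ∀ s, ∀ a : D, σ a.1.1 = s → c a = 0 := by
    intro s
    induction s using Nat.strong_induction_on with
    | _ s ih =>
      intro a ha
      let T := (D.image Prod.fst).filter (fun x => s < σ x)
      let Y := ((D.filter (fun b => b.1 = a.1.1)).image Prod.snd).erase a.1.2
      have hT : T.card ≤ m - s := by
        have h1 : (T.image σ).card = T.card := by
          apply Finset.card_image_of_injOn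
          intro x hx y hy hxy
          simp only [T, Finset.coe_filter, Finset.mem_image, Set.mem_ofPred_eq] at hx hy
          obtain ⟨⟨x', hx', rfl⟩, -⟩ := hx
          obtain ⟨⟨y', hy', rfl⟩, -⟩ := hy
          exact hinj _ hx' _ hy' hxy
        have h2 : T.image σ ⊆ Finset.Ioc s m := by
          intro z hz
          simp only [T, Finset.mem_image, Finset.mem_filter] at hz
          obtain ⟨x, ⟨⟨x', hx', rfl⟩, hs⟩, rfl⟩ := hz
          exact Finset.mem_Ioc.2 ⟨hs, hm _ hx'⟩
        have := Finset.card_le_card h2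
        rw [Nat.card_Ioc] at this
        omega
      have hY : Y.card + 1 ≤ s := by
        have h1 : a.1.2 ∈ (D.filter (fun b => b.1 = a.1.1)).image Prod.snd :=
          Finset.mem_image.2 ⟨a.1, Finset.mem_filter.2 ⟨a.2, rfl⟩, rfl⟩
        have h2 := Finset.card_erase_add_one h1
        have h3 : ((D.filter (fun b => b.1 = a.1.1)).image Prod.snd).card ≤ _ :=
          Finset.card_image_le
        have h4 := hcol a.1 a.2
        simp only [Y]
        omega
      have hsm := hm a.1 a.2
      have h := hcc (∏ x ∈ T, (Polynomial.X - Polynomial.C (x : K)))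
        (∏ y ∈ Y, (Polynomial.X - Polynomial.C (y : K))) (by
          rw [Polynomial.natDegree_finsetProd_X_sub_C_eq_card,
            Polynomial.natDegree_finsetProd_X_sub_C_eq_card]
          omega)
      rw [Finset.sum_eq_single a] at h
      · rcases mul_eq_zero.1 h with h | h
        · exfalso
          simp only [Polynomial.eval_prod, Polynomial.eval_sub, Polynomial.eval_X,
            Polynomial.eval_C, mul_eq_zero, Finset.prod_eq_zero_iff, sub_eq_zero,
            Nat.cast_inj] at h
          rcases h with ⟨x, hx, hxa⟩ | ⟨y, hy, hya⟩
          · simp only [T, Finset.mem_filter] at hx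
            rw [← hxa] at hx
            omega
          · simp only [Y, Finset.mem_erase] at hy
            exact hy.1 hya.symm
        · exact h
      · intro b _ hba
        by_cases hx : b.1.1 = a.1.1
        · have : (∏ y ∈ Y, (Polynomial.X - Polynomial.C (y : K))).eval (b.1.2 : K) = 0 := by
            rw [Polynomial.eval_prod]
            refine Finset.prod_eq_zero (i := b.1.2) ?_ (by simp)
            refine Finset.mem_erase.2 ⟨fun h => hba (Subtype.ext (Prod.ext hx h)), ?_⟩
            exact Finset.mem_image.2 ⟨b.1, Finset.mem_filter.2 ⟨b.2, hx⟩, rfl⟩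
          rw [this]; ring
        · rcases lt_trichotomy (σ b.1.1) s with h1 | h1 | h1
          · rw [ih _ h1 b rfl, mul_zero]
          · exact absurd (hinj _ b.2 _ a.2 (h1.trans ha.symm)) hx
          · have : (∏ x ∈ T, (Polynomial.X - Polynomial.C (x : K))).eval (b.1.1 : K) = 0 := by
              rw [Polynomial.eval_prod]
              refine Finset.prod_eq_zero (i := b.1.1) ?_ (by simp)
              exact Finset.mem_filter.2 ⟨Finset.mem_image.2 ⟨b.1, b.2, rfl⟩, h1⟩
            rw [this]; ring
      · intro h; exact absurd (Finset.mem_univ _) h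
  exact funext fun a => main _ a rfl

end good
end EoLS
namespace EoLS
section geom
variable {K : Type*} [Field K] [CharZero K]

lemma two_choose (n : ℕ) : 2 * (n + 1).choose 2 = n * (n + 1) := by
  induction n with
  | zero => simp
  | succ n ih =>
    have : (n + 1 + 1).choose 2 = (n + 1) + (n + 1).choose 2 := by
      rw [Nat.choose_succ_succ' (n + 1) 1, Nat.choose_one_right]
    rw [this, mul_add, ih]; ring

/-- the parallelogram `a ≤ i ≤ a+m`, `n ≤ i+j < N` -/
def par (n N a b : ℕ) : Finset (ℕ × ℕ) :=
  (tri N).filter (fun x => a ≤ x.1 ∧ x.1 < b ∧ n ≤ x.1 + x.2)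

lemma mem_par {n N a b : ℕ} {x : ℕ × ℕ} :
    x ∈ par n N a b ↔ x.1 + x.2 < N ∧ a ≤ x.1 ∧ x.1 < b ∧ n ≤ x.1 + x.2 := by
  simp [par, mem_tri]

lemma good_layer (m n a : ℕ) (h : a + m ≤ n) : Good K m (par n (n + m) a (a + m + 1)) 2 := by
  let lo := (par n (n + m) a (a + m + 1)).filter (fun x => x.2 + a < n)
  let up := (par n (n + m) a (a + m + 1)).filter (fun x => ¬ x.2 + a < n)
  have hlo : ∀ x, x ∈ lo ↔ a ≤ x.1 ∧ x.1 ≤ a + m ∧ n ≤ x.1 + x.2 ∧ x.2 + a < n := by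
    intro x; simp only [lo, Finset.mem_filter, mem_par]; omega
  have hup : ∀ x, x ∈ up ↔ a ≤ x.1 ∧ x.1 + x.2 < n + m ∧ n ≤ x.2 + a := by
    intro x; simp only [up, Finset.mem_filter, mem_par]; omega
  have glo : Good K m lo 1 := by
    apply Good.single ?_ (fun x => x - a)
    · intro x hx y hy hxy
      rw [hlo] at hx hy
      omega
    · intro x hx
      rw [hlo] at hx
      omega
    · intro x hx
      rw [hlo] at hx
      have : (lo.filter (fun b => b.1 = x.1)) ⊆ {x.1} ×ˢ Finset.Ico (n - x.1) (n - a) := by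
        intro y hy
        rw [Finset.mem_filter, hlo] at hy
        rw [Finset.mem_product, Finset.mem_singleton, Finset.mem_Ico]
        omega
      have := Finset.card_le_card this
      rw [Finset.card_product, Finset.card_singleton, Nat.card_Ico] at this
      omega
    · refine Finset.card_nbij' (fun x => (a + m - x.1, x.1 + x.2 - n))
        (fun y => (a + m - y.1, n + y.2 + y.1 - a - m)) ?_ ?_ ?_ ?_
      · intro x hx
        rw [Finset.mem_coe, hlo] at hx
        rw [Finset.mem_coe, mem_tri]
        simp only; omega
      · intro x hx
        rw [Finset.mem_coe, mem_tri] at hx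
        rw [Finset.mem_coe, hlo]
        simp only; omega
      · intro x hx
        rw [Finset.mem_coe, hlo] at hx
        refine Prod.ext ?_ ?_ <;> simp only <;> omega
      · intro x hx
        rw [Finset.mem_coe, mem_tri] at hx
        refine Prod.ext ?_ ?_ <;> simp only <;> omega
  have gup : Good K m up 1 := by
    apply Good.single ?_ (fun x => a + m - x)
    · intro x hx y hy hxy
      rw [hup] at hx hy
      omega
    · intro x hx
      rw [hup] at hx
      omega
    · intro x hx
      rw [hup] at hx
      have : (up.filter (fun b => b.1 = x.1)) ⊆ {x.1} ×ˢ Finset.Ico (n - a) (n + m - x.1) := by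
        intro y hy
        rw [Finset.mem_filter, hup] at hy
        rw [Finset.mem_product, Finset.mem_singleton, Finset.mem_Ico]
        omega
      have := Finset.card_le_card this
      rw [Finset.card_product, Finset.card_singleton, Nat.card_Ico] at this
      omega
    · refine Finset.card_nbij' (fun x => (x.1 - a, x.2 + a - n))
        (fun y => (a + y.1, n + y.2 - a)) ?_ ?_ ?_ ?_
      · intro x hx
        rw [Finset.mem_coe, hup] at hx
        rw [Finset.mem_coe, mem_tri]
        simp only; omega
      · intro x hx
        rw [Finset.mem_coe, mem_tri] at hx
        rw [Finset.mem_coe, hup]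
        simp only; omega
      · intro x hx
        rw [Finset.mem_coe, hup] at hx
        refine Prod.ext ?_ ?_ <;> simp only <;> omega
      · intro x hx
        rw [Finset.mem_coe, mem_tri] at hx
        refine Prod.ext ?_ ?_ <;> simp only <;> omega
  have := glo.union gup 0 (-1) (by
    intro x hx y hy
    rw [hlo] at hx
    rw [hup] at hy
    omega)
  rwa [Finset.filter_union_filter_not_eq] at this

lemma good_block (m n a L : ℕ) (h : a + m ≤ n) :
    Good K m (par n (n + L * m) a (a + m + 1)) (2 * L) := by
  induction L with
  | zero =>
    have : par n (n + 0 * m) a (a + m + 1) = ∅ := by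
      ext x
      simp only [mem_par, Finset.notMem_empty, iff_false]; omega
    rw [this]; exact Good.empty m
  | succ L ih =>
    have h1 := good_layer (K := K) m (n + L * m) a (by omega)
    have h2 := ih.union h1 (-1) (-1) (by
      intro x hx y hy
      rw [mem_par] at hx hy
      omega)
    convert h2 using 1
    · ext x
      rw [Finset.mem_union, mem_par, mem_par, mem_par, add_mul L 1 m, one_mul]
      omega
    · ring

lemma good_blocks (m n q L : ℕ) (h : q * (m + 1) ≤ n) :
    Good K m (par n (n + L * m) 0 (q * (m + 1))) (q * (2 * L)) := by
  induction q with
  | zero =>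
    have : par n (n + L * m) 0 (0 * (m + 1)) = ∅ := by
      ext x
      simp only [mem_par, Finset.notMem_empty, iff_false]; omega
    rw [this]; simpa using Good.empty m
  | succ q ih =>
    rw [add_mul q 1 (m + 1)] at h
    have h1 := good_block (K := K) m n (q * (m + 1)) L (by omega)
    have h2 := (ih (by omega)).union h1 (-1) 0 (by
      intro x hx y hy
      rw [mem_par] at hx hy
      omega)
    convert h2 using 1
    · ext x
      rw [Finset.mem_union, mem_par, mem_par, mem_par, add_mul q 1 (m + 1)]
      omega
    · ring

lemma good_eols (m k : ℕ) (hk : 1 ≤ k)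
    (h : nonSpecial K (eolsDiagram (m * (m + 1)) k)
        (fun _ : Fin (2 * k + m * (m + 1) - 1) => m)) (hm : 0 < m) :
    Good K m (eolsDiagram (m * (m + 1)) k) (2 * k + m * (m + 1) - 1) := by
  have hpos : 0 < m * (m + 1) := by positivity
  have hB := two_choose m
  rw [← card_tri] at hB
  generalize m * (m + 1) = h' at *
  have hc : (eolsDiagram h' k).card = (2 * k + h' - 1) * (tri m).card := by
    obtain ⟨k, rfl⟩ : ∃ k', k = k' + 1 := ⟨k - 1, by omega⟩
    have h1 : tri (k + h') = eolsDiagram h' (k + 1) ∪ tri k := by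
      ext x
      simp only [mem_tri, eolsDiagram, Finset.mem_union, Finset.mem_filter, Finset.mem_product,
        Finset.mem_range]
      omega
    have h2 : Disjoint (eolsDiagram h' (k + 1)) (tri k) := by
      rw [Finset.disjoint_left]
      intro x
      simp only [mem_tri, eolsDiagram, Finset.mem_filter]
      omega
    have h3 := congrArg Finset.card h1
    rw [Finset.card_union_of_disjoint h2, card_tri, card_tri k] at h3
    have h4 := two_choose (k + h')
    have h5 := two_choose k
    have h6 : 2 * (k + 1) + h' - 1 = 2 * k + h' + 1 := by omega
    rw [h6]
    have h7 : 2 * ((2 * k + h' + 1) * (tri m).card) = (2 * k + h' + 1) * h' := by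
      rw [← hB]; ring
    nlinarith
  refine ⟨hc, ?_⟩
  obtain ⟨p, hp, hk⟩ := (ns_iff m _ _).1 h
  exact ⟨p, hp, by omega⟩

lemma good_strip (m n : ℕ) (hm : 0 < m)
    (hE : ∀ k, 1 ≤ k → k ≤ m + 1 →
      nonSpecial K (eolsDiagram (m * (m + 1)) k)
        (fun _ : Fin (2 * k + m * (m + 1) - 1) => m)) :
    ∃ R, Good K m (par n (n + m * (m + 1)) 0 (n + m * (m + 1))) R := by
  obtain ⟨q, k, hq, hk⟩ : ∃ q k, n = q * (m + 1) + k ∧ k ≤ m :=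
    ⟨n / (m + 1), n % (m + 1), by rw [mul_comm]; exact (Nat.div_add_mod _ _).symm, by
      have := Nat.mod_lt n (show 0 < m + 1 by omega)
      omega⟩
  have h1 := good_eols (K := K) m (k + 1) (by omega) (hE (k + 1) (by omega) (by omega)) hm
  have h2 := h1.shift (q * (m + 1)) (par n (n + m * (m + 1)) (q * (m + 1)) (n + m * (m + 1))) (by
    intro x
    rw [mem_par]
    generalize m * (m + 1) = h'
    generalize q * (m + 1) = c at *
    simp only [eolsDiagram, Finset.mem_filter, Finset.mem_product, Finset.mem_range]
    constructor
    · intro hx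
      refine ⟨(x.1 - c, x.2), ?_, ?_⟩
      · simp only; omega
      · refine Prod.ext ?_ ?_ <;> simp only <;> omega
    · rintro ⟨y, hy, rfl⟩
      simp only
      omega)
  have h3 := good_blocks (K := K) m n q (m + 1) (by omega)
  rw [mul_comm (m + 1) m] at h3
  have h4 := h3.union h2 (-1) 0 (by
    intro x hx y hy
    rw [mem_par] at hx hy
    omega)
  refine ⟨q * (2 * (m + 1)) + (2 * (k + 1) + m * (m + 1) - 1), ?_⟩
  convert h4 using 1
  ext x
  rw [Finset.mem_union, mem_par, mem_par, mem_par]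
  generalize m * (m + 1) = h'
  generalize q * (m + 1) = c at *
  omega

lemma step (m n : ℕ) (hm : 0 < m)
    (hE : ∀ k, 1 ≤ k → k ≤ m + 1 →
      nonSpecial K (eolsDiagram (m * (m + 1)) k)
        (fun _ : Fin (2 * k + m * (m + 1) - 1) => m))
    (ih : ∀ p : ℕ, nonSpecial K (tri n) (fun _ : Fin p => m)) (p : ℕ) :
    nonSpecial K (tri (n + m * (m + 1))) (fun _ : Fin p => m) := by
  obtain ⟨R, hR⟩ := good_strip (K := K) m n hm hE
  have hU : tri (n + m * (m + 1)) = tri n ∪ par n (n + m * (m + 1)) 0 (n + m * (m + 1)) := by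
    ext x
    rw [Finset.mem_union, mem_par, mem_tri, mem_tri]
    omega
  have hsep : ∀ a ∈ tri n, ∀ b ∈ par n (n + m * (m + 1)) 0 (n + m * (m + 1)),
      (-1 : ℤ) * b.1 + (-1) * b.2 < (-1) * a.1 + (-1) * a.2 := by
    intro x hx y hy
    rw [mem_par] at hy
    rw [mem_tri] at hx
    omega
  rw [ns_iff, hU]
  have hcR := hR.1
  rcases Nat.lt_or_ge p R with hlt | hge
  · obtain ⟨p₀, hp₀, -⟩ := (ns_iff m _ _).1 (ih 0)
    obtain ⟨hc, P, hP, hk⟩ := cutD p₀ hp₀ hR (-1) (-1) hsep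
    have hk0 : kD m (tri n) p₀ ≤ (tri n).card := by
      have := kd_add_rank (MT m (Subtype.val : tri n → ℕ × ℕ) p₀)
      rw [Fintype.card_coe] at this
      unfold kD
      omega
    obtain ⟨s, rfl⟩ : ∃ s, R = p + s := ⟨R - p, by omega⟩
    let e : Fin p ⊕ Fin s ≃ Fin (0 + (p + s)) :=
      finSumFinEquiv.trans (finCongr (Nat.zero_add _).symm)
    refine ⟨P ∘ e ∘ Sum.inl, fun j => hP _, ?_⟩
    have h1 := kd_drop m (Subtype.val :
      (tri n ∪ par n (n + m * (m + 1)) 0 (n + m * (m + 1)) : Finset (ℕ × ℕ)) → ℕ × ℕ)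
      (P ∘ e ∘ Sum.inl) (P ∘ e ∘ Sum.inr)
    have h2 : Sum.elim (P ∘ e ∘ Sum.inl) (P ∘ e ∘ Sum.inr) = P ∘ e := by
      ext x : 1
      rcases x with x | x <;> rfl
    rw [h2, kd_comp_pts, Fintype.card_fin] at h1
    unfold kD at *
    rw [add_mul] at hcR
    omega
  · obtain ⟨s, rfl⟩ : ∃ s, p = s + R := ⟨p - R, by omega⟩
    obtain ⟨p₀, hp₀, hk0⟩ := (ns_iff m _ _).1 (ih s)
    obtain ⟨hc, P, hP, hk⟩ := cutD p₀ hp₀ hR (-1) (-1) hsep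
    refine ⟨P, hP, ?_⟩
    rw [add_mul]
    omega

end geom
end EoLS

/-- Let `m, d_L ≥ 1`.  Assume that for every `d` with
`d_L ≤ d ≤ d_L + m(m+1)` and every `p ∈ ℕ` the system `L_d(m^{×p})` is non-special, and
that every system in `EoLS(m)` is non-special.  Then for every `d ≥ d_L` and every
`p ∈ ℕ` the system `L_d(m^{×p})` is non-special. -/
theorem statement12 {K : Type*} [Field K] [CharZero K]
    (m dL : ℕ) (hm : 0 < m) (hdL : 0 < dL)
    (h1 : ∀ d, dL ≤ d → d ≤ dL + m * (m + 1) → ∀ p : ℕ,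
      nonSpecial K (fullDiagram d) (fun _ : Fin p => m))
    (hEoLS : ∀ k, 1 ≤ k → k ≤ m + 1 →
      nonSpecial K (eolsDiagram (m * (m + 1)) k)
        (fun _ : Fin (2 * k + m * (m + 1) - 1) => m)) :
    ∀ d, dL ≤ d → ∀ p : ℕ, nonSpecial K (fullDiagram d) (fun _ : Fin p => m) := by

  intro d
  induction d using Nat.strong_induction_on with
  | _ d ih =>
    intro hd p
    by_cases hle : d ≤ dL + m * (m + 1)
    · exact h1 d hd hle p
    have hpos : 0 < m * (m + 1) := by positivity
    have h2 := EoLS.step (K := K) m (d - m * (m + 1) + 1) hm hEoLS (by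
      intro p
      rw [← EoLS.full_eq]
      exact ih _ (by omega) (by omega) p) p
    rw [EoLS.full_eq]
    convert h2 using 2
    omega
end

section
/- Let m, d_0 be positive integers. If every system in the set S(m,d_0) is non-special, then every system L_d(m^{×r}) with d ≥ d_0 and r ∈ ℕ is non-special. -/
open MvPolynomial

lemma semicont {K : Type*} [Field K] {ι κ : Type*} [Fintype ι] [Fintype κ] [DecidableEq κ]
    (M : Matrix ι κ (Polynomial K)) : ∃ q : Polynomial K, q ≠ 0 ∧ ∀ s, q.eval s ≠ 0 →
    Module.finrank K (LinearMap.ker (M.map (Polynomial.eval s)).mulVecLin) ≤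
    Module.finrank K (LinearMap.ker (M.map (Polynomial.eval 0)).mulVecLin) := by
  classical
  set f := (M.map (Polynomial.eval 0)).mulVecLin with hf
  obtain ⟨W, hW⟩ := Submodule.exists_isCompl (LinearMap.ker f)
  have hinj : LinearMap.ker (f ∘ₗ W.subtype) = ⊥ := by
    rw [LinearMap.ker_comp]
    rw [Submodule.eq_bot_iff]
    rintro ⟨x, hx⟩ hx'
    have : x ∈ LinearMap.ker f ⊓ W := ⟨by simpa using hx', hx⟩
    rw [hW.inf_eq_bot] at this
    simpa using this
  obtain ⟨g, hg⟩ := LinearMap.exists_leftInverse_of_injective _ hinj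
  let b := Module.finBasis K W
  let n := Module.finrank K W
  let P : Matrix (Fin n) ι K := LinearMap.toMatrix (Pi.basisFun K ι) b g
  let Q : Matrix κ (Fin n) K := LinearMap.toMatrix b (Pi.basisFun K κ) W.subtype
  have hM : ∀ s, P * (M.map (Polynomial.eval s)) * Q =
      (P.map Polynomial.C * M * Q.map Polynomial.C).map (Polynomial.eval s) := by
    intro s
    have h1 : ∀ (A : Matrix (Fin n) ι K), (A.map Polynomial.C).map (Polynomial.eval s) = A := by
      intro A; ext; simp
    have h2 : ∀ (A : Matrix κ (Fin n) K), (A.map Polynomial.C).map (Polynomial.eval s) = A := by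
      intro A; ext; simp
    have := Matrix.map_mul (L := P.map Polynomial.C * M) (M := Q.map Polynomial.C) (f := Polynomial.evalRingHom s)
    have h3 := Matrix.map_mul (L := P.map Polynomial.C) (M := M) (f := Polynomial.evalRingHom s)
    simp only [Polynomial.coe_evalRingHom] at this h3
    rw [this, h3, h1, h2]
  have h0 : P * (M.map (Polynomial.eval 0)) * Q = 1 := by
    have e : M.map (Polynomial.eval 0) = LinearMap.toMatrix (Pi.basisFun K κ) (Pi.basisFun K ι) f := by
      rw [hf]
      change _ = LinearMap.toMatrix' _
      rw [← Matrix.toLin'_apply', LinearMap.toMatrix'_toLin']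
    rw [e, Matrix.mul_assoc, ← LinearMap.toMatrix_comp, ← LinearMap.toMatrix_comp, hg,
      LinearMap.toMatrix_id]
  refine ⟨(P.map Polynomial.C * M * Q.map Polynomial.C).det, ?_, ?_⟩
  · intro h
    have : ((P.map Polynomial.C * M * Q.map Polynomial.C).map (Polynomial.eval 0)).det = 0 := by
      have := RingHom.map_det (Polynomial.evalRingHom (0:K)) (P.map Polynomial.C * M * Q.map Polynomial.C)
      rw [h] at this
      simpa using this.symm
    rw [← hM, h0] at this
    simp at this
  · intro s hs
    have hdet : ((P.map Polynomial.C * M * Q.map Polynomial.C).map (Polynomial.eval s)).det ≠ 0 := by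
      have := RingHom.map_det (Polynomial.evalRingHom s) (P.map Polynomial.C * M * Q.map Polynomial.C)
      simp only [Polynomial.coe_evalRingHom] at this
      rw [this] at hs
      exact hs
    rw [← hM] at hdet
    have hr : (P * (M.map (Polynomial.eval s)) * Q).rank = n := by
      rw [Matrix.rank_of_isUnit _ ((Matrix.isUnit_iff_isUnit_det _).2 (isUnit_iff_ne_zero.2 hdet))]
      simp
    have hr2 : n ≤ (M.map (Polynomial.eval s)).rank := by
      rw [← hr]
      exact (Matrix.rank_mul_le_left _ _).trans (Matrix.rank_mul_le_right _ _)
    have e1 := LinearMap.finrank_range_add_finrank_ker (M.map (Polynomial.eval s)).mulVecLin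
    have e2 := Submodule.finrank_add_eq_of_isCompl hW
    change n ≤ Module.finrank K (LinearMap.range (M.map (Polynomial.eval s)).mulVecLin) at hr2
    change _ + n = _ at e2
    omega

lemma fr_add {K V W : Type*} [Field K] [AddCommGroup V] [Module K V] [AddCommGroup W] [Module K W]
    [FiniteDimensional K V] (S : Submodule K V) (f : V →ₗ[K] W) :
    Module.finrank K S = Module.finrank K (S.map f) +
      Module.finrank K (S ⊓ LinearMap.ker f : Submodule K V) := by
  have := LinearMap.finrank_range_add_finrank_ker (f.domRestrict S)
  rw [LinearMap.range_domRestrict, LinearMap.ker_domRestrict] at this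
  rw [← this]
  congr 1
  rw [← Submodule.map_comap_subtype]
  exact (Submodule.equivMapOfInjective S.subtype S.injective_subtype _).finrank_eq

lemma block_ker {K : Type*} [Field K] {ι₁ ι₂ κ₁ κ₂ : Type*} [Fintype ι₁] [Fintype ι₂]
    [Fintype κ₁] [Fintype κ₂]
    (A : Matrix ι₁ κ₁ K) (B : Matrix ι₁ κ₂ K) (D : Matrix ι₂ κ₂ K) :
    Module.finrank K (LinearMap.ker (Matrix.fromBlocks A B 0 D).mulVecLin) ≤
    Module.finrank K (LinearMap.ker A.mulVecLin) +
    Module.finrank K (LinearMap.ker D.mulVecLin) := by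
  rw [fr_add _ (LinearMap.funLeft K K (Sum.inr : κ₂ → κ₁ ⊕ κ₂)), add_comm]
  apply add_le_add
  · let g : (κ₁ ⊕ κ₂ → K) →ₗ[K] (κ₁ → K) := LinearMap.funLeft K K Sum.inl
    refine LinearMap.finrank_le_finrank_of_injective
      (f := g.restrict (p := _ ⊓ _) (q := LinearMap.ker A.mulVecLin) ?_) ?_
    · intro x hx
      obtain ⟨h1, h2⟩ := hx
      have h1 : (Matrix.fromBlocks A B 0 D).mulVecLin x = 0 := h1
      rw [Matrix.mulVecLin_apply, Matrix.fromBlocks_mulVec] at h1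
      have h2' : x ∘ Sum.inr = 0 := h2
      rw [h2'] at h1
      have := congrArg (fun y => y ∘ Sum.inl) h1
      simp only [Sum.elim_comp_inl, Matrix.mulVec_zero, add_zero] at this
      exact this
    · rintro ⟨x, hx⟩ ⟨y, hy⟩ h
      have h : x ∘ Sum.inl = y ∘ Sum.inl := congrArg Subtype.val h
      have hx2 : x ∘ Sum.inr = 0 := hx.2
      have hy2 : y ∘ Sum.inr = 0 := hy.2
      ext i
      rcases i with i | i
      · exact congrFun h i
      · exact (congrFun hx2 i).trans (congrFun hy2 i).symm
  · apply Submodule.finrank_mono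
    rintro _ ⟨x, hx, rfl⟩
    have h1 : (Matrix.fromBlocks A B 0 D).mulVecLin x = 0 := hx
    rw [Matrix.mulVecLin_apply, Matrix.fromBlocks_mulVec] at h1
    have := congrArg (fun y => y ∘ Sum.inr) h1
    simp only [Sum.elim_comp_inr, Matrix.zero_mulVec, zero_add] at this
    exact this

/-- The triangle `i + j < n`. -/
def triF (n : ℕ) : Finset (ℕ × ℕ) :=
  (Finset.range n ×ˢ Finset.range n).filter (fun x => x.1 + x.2 < n)

lemma mem_triF {n : ℕ} {x : ℕ × ℕ} : x ∈ triF n ↔ x.1 + x.2 < n := by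
  simp only [triF, Finset.mem_filter, Finset.mem_product, Finset.mem_range]
  omega

lemma card_triF (n : ℕ) : (triF n).card * 2 = n * (n + 1) := by
  induction n with
  | zero => simp [triF]
  | succ n ih =>
    have : triF (n + 1) = triF n ∪ Finset.HasAntidiagonal.antidiagonal n := by
      ext x; simp only [mem_triF, Finset.mem_union, Finset.HasAntidiagonal.mem_antidiagonal]; omega
    rw [this, Finset.card_union_of_disjoint, Finset.Nat.card_antidiagonal, add_mul, ih]
    · ring
    · rw [Finset.disjoint_left]; intro x; simp only [mem_triF, Finset.HasAntidiagonal.mem_antidiagonal]; omega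

lemma card_triF' (n : ℕ) : (triF n).card = (n + 1).choose 2 := by
  have := card_triF n
  rw [Nat.choose_two_right, Nat.add_sub_cancel, mul_comm (n+1) n, ← this]
  simp

lemma fullDiagram_eq (d : ℕ) : fullDiagram d = triF (d + 1) := by
  ext x; simp only [mem_triF, fullDiagram, Finset.mem_filter, Finset.mem_product, Finset.mem_range]
  omega

/-- value at `p` of the `β`-derivative of the monomial with exponent `α`. -/
def phi {K : Type*} [Field K] (p : K × K) (β α : ℕ × ℕ) : K :=
  ((α.1.descFactorial β.1 : ℕ) : K) * p.1 ^ (α.1 - β.1) *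
    (((α.2.descFactorial β.2 : ℕ) : K) * p.2 ^ (α.2 - β.2))

/-- matrix of conditions -/
def hcMat {K : Type*} [Field K] (m : ℕ) (D : Finset (ℕ × ℕ)) {r : ℕ} (p : Fin r → K × K) :
    Matrix (Fin r × triF m) D K :=
  Matrix.of fun i α => phi (p i.1) i.2 α

lemma pderiv_pow_monomial {K : Type*} [Field K] (i : Fin 2) (n : ℕ) (s : Fin 2 →₀ ℕ) (a : K) :
    ((pderiv i).toLinearMap ^ n : Module.End K (MvPolynomial (Fin 2) K)) (monomial s a) =
      monomial (s - Finsupp.single i n) (a * ((s i).descFactorial n : ℕ)) := by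
  induction n with
  | zero => simp
  | succ n ih =>
    rw [pow_succ', Module.End.mul_apply, ih]
    simp only [Derivation.coeFn_coe, pderiv_monomial]
    rw [tsub_tsub, ← Finsupp.single_add, Nat.descFactorial_succ]
    congr 1
    simp only [Finsupp.coe_tsub, Pi.sub_apply, Finsupp.single_eq_same]
    push_cast
    ring

lemma eval_deriv_monomial {K : Type*} [Field K] (p : K × K) (β α : ℕ × ℕ) :
    evalPt K p (derivOp K β
      (monomial (Finsupp.single (0 : Fin 2) α.1 + Finsupp.single 1 α.2) (1 : K))) = phi p β α := by
  rw [derivOp, Module.End.mul_apply, pderiv_pow_monomial, pderiv_pow_monomial, evalPt]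
  simp only [AlgHom.toLinearMap_apply, aeval_monomial, phi]
  rw [Finsupp.prod_fintype _ _ (by simp)]
  simp [Fin.prod_univ_two]
  ring

/-- coefficient embedding -/
noncomputable def coefE (K : Type*) [Field K] (D : Finset (ℕ × ℕ)) :
    (D → K) →ₗ[K] MvPolynomial (Fin 2) K :=
  Fintype.linearCombination K (fun d : D =>
    (monomial (Finsupp.single (0 : Fin 2) d.1.1 + Finsupp.single 1 d.1.2) (1 : K)))

lemma coefE_inj (K : Type*) [Field K] (D : Finset (ℕ × ℕ)) : Function.Injective (coefE K D) := by
  have h := (MvPolynomial.basisMonomials (Fin 2) K).linearIndependent.comp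
    (fun d : D => Finsupp.single (0 : Fin 2) d.1.1 + Finsupp.single 1 d.1.2) (by
      rintro ⟨⟨a, b⟩, h1⟩ ⟨⟨c, d⟩, h2⟩ h
      have e0 := DFunLike.congr_fun h 0
      have e1 := DFunLike.congr_fun h 1
      simp at e0 e1
      simp [e0, e1])
  have h := linearIndependent_iff_injective_fintypeLinearCombination.1 h
  have e : (⇑(MvPolynomial.basisMonomials (Fin 2) K) ∘
    (fun d : D => Finsupp.single (0 : Fin 2) d.1.1 + Finsupp.single 1 d.1.2)) = (fun d : D =>
    (monomial (Finsupp.single (0 : Fin 2) d.1.1 + Finsupp.single 1 d.1.2) (1 : K))) := by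
    funext d; simp
  rw [e] at h
  exact h

lemma coefE_range (K : Type*) [Field K] (D : Finset (ℕ × ℕ)) :
    LinearMap.range (coefE K D) = monoSpan K D := by
  rw [coefE, Fintype.range_linearCombination, monoSpan]
  congr 1
  ext x
  simp

lemma coefE_cond {K : Type*} [Field K] (D : Finset (ℕ × ℕ)) (c : D → K) (p : K × K) (β : ℕ × ℕ) :
    (evalPt K p ∘ₗ derivOp K β) (coefE K D c) = ∑ α : D, phi p β α * c α := by
  rw [coefE, Fintype.linearCombination_apply, map_sum]
  refine Finset.sum_congr rfl fun α _ => ?_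
  rw [map_smul, LinearMap.comp_apply, eval_deriv_monomial, smul_eq_mul, mul_comm]

lemma finrank_lin {K : Type*} [Field K] (m : ℕ) (D : Finset (ℕ × ℕ)) {r : ℕ}
    (p : Fin r → K × K) :
    Module.finrank K (linSysPts K D (fun _ => m) p) =
      Module.finrank K (LinearMap.ker (hcMat m D p).mulVecLin) := by
  have : linSysPts K D (fun _ => m) p =
      (LinearMap.ker (hcMat m D p).mulVecLin).map (coefE K D) := by
    ext F
    simp only [linSysPts, ← coefE_range, Submodule.mem_inf, Submodule.mem_iInf, Submodule.mem_map,
      LinearMap.mem_range, LinearMap.mem_ker]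
    constructor
    · rintro ⟨⟨c, rfl⟩, h⟩
      refine ⟨c, ?_, rfl⟩
      funext i
      have := h i.1 i.2 (mem_triF.1 i.2.2)
      rw [coefE_cond] at this
      exact this
    · rintro ⟨c, h, rfl⟩
      refine ⟨⟨c, rfl⟩, fun j β hβ => ?_⟩
      rw [coefE_cond]
      exact congrFun h (j, ⟨β, mem_triF.2 hβ⟩)
  rw [this]
  exact (Submodule.equivMapOfInjective _ (coefE_inj K D) _).finrank_eq.symm

/-- the system with some points has vector dimension at most `e` -/
def Reg (K : Type*) [Field K] (m : ℕ) (D : Finset (ℕ × ℕ)) (r e : ℕ) : Prop :=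
  ∃ p : Fin r → K × K, Module.finrank K (LinearMap.ker (hcMat m D p).mulVecLin) ≤ e

lemma card_le_nul {K : Type*} [Field K] (m : ℕ) (D : Finset (ℕ × ℕ)) {r : ℕ}
    (p : Fin r → K × K) :
    D.card ≤ Module.finrank K (LinearMap.ker (hcMat m D p).mulVecLin) + r * (triF m).card := by
  have := LinearMap.finrank_range_add_finrank_ker (hcMat m D p).mulVecLin
  have h2 := Submodule.finrank_le (LinearMap.range (hcMat m D p).mulVecLin)
  simp only [Module.finrank_fintype_fun_eq_card, Fintype.card_prod, Fintype.card_fin,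
    Fintype.card_coe] at this h2
  omega

lemma vdim_eq (m : ℕ) (D : Finset (ℕ × ℕ)) (r : ℕ) :
    vdimSys D (fun _ : Fin r => m) = (D.card : ℤ) - 1 - r * (triF m).card := by
  simp [vdimSys, card_triF']

lemma nonSpecial_iff {K : Type*} [Field K] (m : ℕ) (D : Finset (ℕ × ℕ)) (r : ℕ) :
    nonSpecial K D (fun _ : Fin r => m) ↔ Reg K m D r (D.card - r * (triF m).card) := by
  rw [nonSpecial, vdim_eq, dimSys]
  simp only [finrank_lin]
  set S := Set.range fun p : Fin r → K × K =>
    (Module.finrank K (LinearMap.ker (hcMat m D p).mulVecLin) : ℤ) - 1 with hS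
  have hne : S.Nonempty := Set.range_nonempty _
  have hbd : BddBelow S := by
    refine ⟨-1, ?_⟩
    rintro _ ⟨p, rfl⟩
    simp only
    omega
  have hlow : max ((D.card : ℤ) - 1 - r * (triF m).card) (-1) ≤ sInf S := by
    apply le_csInf hne
    rintro _ ⟨p, rfl⟩
    have := card_le_nul m D p
    zify at this
    simp only
    apply max_le <;> linarith [Int.natCast_nonneg
      (Module.finrank K (LinearMap.ker (hcMat m D p).mulVecLin))]
  constructor
  · intro h
    obtain ⟨p, hp⟩ := Int.csInf_mem hne hbd
    refine ⟨p, ?_⟩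
    simp only at hp
    rw [h] at hp
    have := card_le_nul m D p
    zify at this
    rcases le_total (D.card) (r * (triF m).card) with h1 | h1
    · zify at h1
      rw [max_eq_right (by linarith)] at hp
      omega
    · zify [h1]
      zify at h1
      rw [max_eq_left (by linarith)] at hp
      linarith
  · rintro ⟨p, hp⟩
    apply le_antisymm _ hlow
    refine (csInf_le hbd ⟨p, rfl⟩).trans ?_
    simp only
    rcases le_total (D.card) (r * (triF m).card) with h1 | h1
    · refine le_trans ?_ (le_max_right _ _)
      omega
    · refine le_trans ?_ (le_max_left _ _)
      zify [h1] at hp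
      linarith

lemma mem_ker_hc {K : Type*} [Field K] {m : ℕ} {D : Finset (ℕ × ℕ)} {r : ℕ}
    {p : Fin r → K × K} {c : D → K} : c ∈ LinearMap.ker (hcMat m D p).mulVecLin ↔
    ∀ j (β : ℕ × ℕ), β.1 + β.2 < m → ∑ α : D, phi (p j) β α * c α = 0 := by
  rw [LinearMap.mem_ker]
  constructor
  · intro h j β hβ
    exact congrFun h (j, ⟨β, mem_triF.2 hβ⟩)
  · intro h
    funext i
    exact h i.1 i.2 (mem_triF.1 i.2.2)

lemma Reg.mono_pts {K : Type*} [Field K] {m : ℕ} {D : Finset (ℕ × ℕ)} {r r' e : ℕ}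
    (h : Reg K m D r e) (hr : r ≤ r') : Reg K m D r' e := by
  obtain ⟨p, hp⟩ := h
  refine ⟨fun i => if h : i.1 < r then p ⟨i, h⟩ else (0, 0), le_trans ?_ hp⟩
  apply Submodule.finrank_mono
  intro c hc
  rw [mem_ker_hc] at hc ⊢
  intro j β hβ
  have := hc (Fin.castLE hr j) β hβ
  simpa using this

lemma Reg.mono_e {K : Type*} [Field K] {m : ℕ} {D : Finset (ℕ × ℕ)} {r e e' : ℕ}
    (h : Reg K m D r e) (hr : e ≤ e') : Reg K m D r e' := by
  obtain ⟨p, hp⟩ := h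
  exact ⟨p, hp.trans hr⟩

lemma Reg.drop {K : Type*} [Field K] {m : ℕ} {D : Finset (ℕ × ℕ)} {r k e : ℕ}
    (h : Reg K m D (r + k) e) : Reg K m D r (e + k * (triF m).card) := by
  obtain ⟨p, hp⟩ := h
  refine ⟨fun i => p (Fin.castAdd k i), ?_⟩
  rw [fr_add _ (hcMat m D (fun i : Fin k => p (Fin.natAdd r i))).mulVecLin, add_comm]
  apply add_le_add
  · refine le_trans ?_ hp
    apply Submodule.finrank_mono
    rintro c ⟨h1, h2⟩
    have h1 := mem_ker_hc.1 h1
    have h2 := mem_ker_hc.1 h2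
    rw [mem_ker_hc]
    intro j
    refine Fin.addCases (fun i => ?_) (fun i => ?_) j
    · exact h1 i
    · exact h2 i
  · refine (Submodule.finrank_le _).trans ?_
    simp

lemma phi_scale {K : Type*} [Field K] (p : K × K) (β α : ℕ × ℕ) (l u : K) :
    phi (l * p.1, u * p.2) β α * (l ^ β.1 * u ^ β.2) = l ^ α.1 * u ^ α.2 * phi p β α := by
  unfold phi
  by_cases h1 : α.1 < β.1
  · simp [Nat.descFactorial_eq_zero_iff_lt.2 h1]
  by_cases h2 : α.2 < β.2
  · simp [Nat.descFactorial_eq_zero_iff_lt.2 h2]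
  have e1 : l ^ α.1 = l ^ (α.1 - β.1) * l ^ β.1 := by rw [← pow_add]; congr 1; omega
  have e2 : u ^ α.2 = u ^ (α.2 - β.2) * u ^ β.2 := by rw [← pow_add]; congr 1; omega
  rw [e1, e2]
  simp only [mul_pow]
  ring

lemma exists_good {K : Type*} [Field K] [CharZero K] (q : Polynomial K) (hq : q ≠ 0) :
    ∃ s, q.eval s ≠ 0 := by
  by_contra! h
  exact hq (Polynomial.funext (by simpa using h))

lemma Reg.cut {K : Type*} [Field K] [CharZero K] {m : ℕ} {D D₁ D₂ : Finset (ℕ × ℕ)}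
    {r₁ r₂ e₁ e₂ : ℕ}
    (h₁ : Reg K m D₁ r₁ e₁) (h₂ : Reg K m D₂ r₂ e₂) (w₁ w₂ θ : ℕ)
    (hD₁ : ∀ α ∈ D₁, θ < w₁ * α.1 + w₂ * α.2) (hD₂ : ∀ α ∈ D₂, w₁ * α.1 + w₂ * α.2 ≤ θ)
    (hD : D = D₁ ∪ D₂) :
    Reg K m D (r₁ + r₂) (e₁ + e₂) := by
  subst hD
  obtain ⟨p, hp⟩ := h₁
  obtain ⟨p', hp'⟩ := h₂
  let w : ℕ × ℕ → ℕ := fun α => w₁ * α.1 + w₂ * α.2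
  let M : Matrix ((Fin r₁ × triF m) ⊕ (Fin r₂ × triF m)) (D₁ ⊕ D₂) (Polynomial K) :=
    Matrix.fromBlocks ((hcMat m D₁ p).map Polynomial.C)
      (Matrix.of fun i α => Polynomial.X ^ (θ - w α) * Polynomial.C (phi (p i.1) i.2 α))
      (Matrix.of fun i α => Polynomial.X ^ (w α - θ) * Polynomial.C (phi (p' i.1) i.2 α))
      ((hcMat m D₂ p').map Polynomial.C)
  obtain ⟨q, hq, hs⟩ := semicont M
  obtain ⟨s, hsq⟩ := exists_good (q * Polynomial.X) (mul_ne_zero hq Polynomial.X_ne_zero)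
  simp only [Polynomial.eval_mul, Polynomial.eval_X, ne_eq, mul_eq_zero, not_or] at hsq
  obtain ⟨hsq, hs0⟩ := hsq
  have hs := hs s hsq
  have hM0 : M.map (Polynomial.eval 0) = Matrix.fromBlocks (hcMat m D₁ p)
      (Matrix.of fun i (α : D₂) => 0 ^ (θ - w α) * phi (p i.1) i.2 α) 0 (hcMat m D₂ p') := by
    ext i α
    rcases i with i | i <;> rcases α with α | α
    · simp [M, hcMat]
    · simp [M, hcMat]; ring
    · have := hD₁ α α.2
      have : w α - θ ≠ 0 := by simp only [w]; omega
      simp [M, this]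
    · simp [M, hcMat]
  have hMs : M.map (Polynomial.eval s) = Matrix.fromBlocks (hcMat m D₁ p)
      (Matrix.of fun i (α : D₂) => s ^ (θ - w α) * phi (p i.1) i.2 α)
      (Matrix.of fun i (α : D₁) => s ^ (w α - θ) * phi (p' i.1) i.2 α) (hcMat m D₂ p') := by
    ext i α
    rcases i with i | i <;> rcases α with α | α <;> simp [M, hcMat] <;> ring
  rw [hM0] at hs
  have hb := hs.trans (block_ker _ _ _)
  set t := s⁻¹ with ht
  have hst : s * t = 1 := mul_inv_cancel₀ hs0
  refine ⟨Fin.append (fun i => (t ^ w₁ * (p i).1, t ^ w₂ * (p i).2)) p', ?_⟩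
  refine le_trans ?_ (hb.trans (add_le_add hp hp'))
  let L : ((D₁ ∪ D₂ : Finset (ℕ × ℕ)) → K) →ₗ[K] (D₁ ⊕ D₂ → K) :=
    { toFun := fun c => Sum.elim (fun α => t ^ (w α - θ) * c ⟨α, Finset.mem_union_left _ α.2⟩)
        (fun α => c ⟨α, Finset.mem_union_right _ α.2⟩)
      map_add' := by
        intro x y; ext i; rcases i with i | i <;> simp [mul_add]
      map_smul' := by
        intro x y; ext i; rcases i with i | i <;> simp [mul_left_comm] }
  have hdisj : Disjoint D₁ D₂ := by
    rw [Finset.disjoint_left]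
    intro α h1 h2
    have := hD₁ α h1
    have := hD₂ α h2
    omega
  have hsum : ∀ g : (D₁ ∪ D₂ : Finset (ℕ × ℕ)) → K, ∑ α, g α =
      ∑ α : D₁, g ⟨α, Finset.mem_union_left _ α.2⟩ +
      ∑ α : D₂, g ⟨α, Finset.mem_union_right _ α.2⟩ := by
    intro g
    rw [← (Equiv.Finset.union D₁ D₂ hdisj).sum_comp, Fintype.sum_sum_type]
    rfl
  refine LinearMap.finrank_le_finrank_of_injective
      (f := L.restrict (q := LinearMap.ker (M.map (Polynomial.eval s)).mulVecLin) ?_) ?_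
  · intro c hc
    rw [mem_ker_hc] at hc
    rw [LinearMap.mem_ker, Matrix.mulVecLin_apply, hMs, Matrix.fromBlocks_mulVec]
    ext i
    rcases i with ⟨j, β⟩ | ⟨j, β⟩
    · have h := hc (Fin.castAdd _ j) β (mem_triF.1 β.2)
      rw [hsum] at h
      simp only [Fin.append_left] at h
      have key : ∀ α : ℕ × ℕ, phi (t ^ w₁ * (p j).1, t ^ w₂ * (p j).2) β α * t ^ (w β) =
          t ^ (w α) * phi (p j) β α := by
        intro α
        have := phi_scale (p j) β α (t ^ w₁) (t ^ w₂)
        simp only [← pow_mul, ← pow_add] at this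
        exact this
      have h' := congrArg (fun x => s ^ θ * t ^ w β * x) h
      simp only [mul_zero, mul_add, Finset.mul_sum] at h'
      simp only [Sum.elim_inl, Pi.add_apply, Pi.zero_apply, Matrix.mulVec, dotProduct, L,
        LinearMap.coe_mk, AddHom.coe_mk, Function.comp_apply, Sum.elim_inr, hcMat, Matrix.of_apply]
      rw [← h']
      congr 1
      · refine Finset.sum_congr rfl fun α _ => ?_
        have h1 : θ < w α := hD₁ α α.2
        have e1 : s ^ θ * t ^ w α = t ^ (w α - θ) := by
          have : w α = θ + (w α - θ) := by omega
          conv_lhs => rw [this, pow_add, ← mul_assoc, ← mul_pow, hst, one_pow, one_mul]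
        rw [← e1]
        linear_combination (- s ^ θ * c ⟨α, Finset.mem_union_left _ α.2⟩) * key α
      · refine Finset.sum_congr rfl fun α _ => ?_
        have h1 : w α ≤ θ := hD₂ α α.2
        have e1 : s ^ θ * t ^ w α = s ^ (θ - w α) := by
          have : θ = (θ - w α) + w α := by omega
          conv_lhs => rw [this, pow_add, mul_assoc, ← mul_pow, hst, one_pow, mul_one]
        rw [← e1]
        linear_combination (- s ^ θ * c ⟨α, Finset.mem_union_right _ α.2⟩) * key α
    · have h := hc (Fin.natAdd _ j) β (mem_triF.1 β.2)
      rw [hsum] at h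
      simp only [Fin.append_right] at h
      simp only [Sum.elim_inr, Pi.add_apply, Pi.zero_apply, Matrix.mulVec, dotProduct, L,
        LinearMap.coe_mk, AddHom.coe_mk, Function.comp_apply, Sum.elim_inl, hcMat, Matrix.of_apply]
      rw [← h]
      congr 1
      refine Finset.sum_congr rfl fun α _ => ?_
      have : s ^ (w α - θ) * t ^ (w α - θ) = 1 := by rw [← mul_pow, hst, one_pow]
      linear_combination (phi (p' j) β α * c ⟨α, Finset.mem_union_left _ α.2⟩) * this
  · rintro ⟨x, hx⟩ ⟨y, hy⟩ h
    have h : L x = L y := congrArg Subtype.val h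
    ext ⟨α, hα⟩
    have t0 : t ≠ 0 := inv_ne_zero hs0
    rcases Finset.mem_union.1 hα with h1 | h1
    · have := congrFun h (Sum.inl ⟨α, h1⟩)
      simp only [L, LinearMap.coe_mk, AddHom.coe_mk, Sum.elim_inl] at this
      exact mul_left_cancel₀ (pow_ne_zero _ t0) this
    · exact congrFun h (Sum.inr ⟨α, h1⟩)

lemma Reg.nz {K : Type*} [Field K] [CharZero K] {m : ℕ} {D : Finset (ℕ × ℕ)} {r e : ℕ}
    (h : Reg K m D r e) : ∃ p : Fin r → K × K, (∀ j, (p j).1 ≠ 0) ∧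
      Module.finrank K (LinearMap.ker (hcMat m D p).mulVecLin) ≤ e := by
  obtain ⟨p, hp⟩ := h
  let M : Matrix (Fin r × triF m) D (Polynomial K) := Matrix.of fun i α =>
    Polynomial.C ((α.1.1.descFactorial i.2.1.1 : ℕ) : K) *
      (Polynomial.C (p i.1).1 + Polynomial.X) ^ (α.1.1 - i.2.1.1) *
    Polynomial.C (((α.1.2.descFactorial i.2.1.2 : ℕ) : K) * (p i.1).2 ^ (α.1.2 - i.2.1.2))
  have hM : ∀ t, M.map (Polynomial.eval t) = hcMat m D (fun j => ((p j).1 + t, (p j).2)) := by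
    intro t
    ext i α
    simp [M, hcMat, phi]
  obtain ⟨q, hq, hs⟩ := semicont M
  have hne : q * ∏ j, (Polynomial.C (p j).1 + Polynomial.X) ≠ 0 := by
    refine mul_ne_zero hq (Finset.prod_ne_zero_iff.2 fun j _ => ?_)
    rw [add_comm]
    exact Polynomial.X_add_C_ne_zero _
  obtain ⟨t, ht⟩ := exists_good _ hne
  rw [Polynomial.eval_mul, Polynomial.eval_prod, mul_ne_zero_iff, Finset.prod_ne_zero_iff] at ht
  have := hs t ht.1
  rw [hM, hM] at this
  have e0 : (fun j => ((p j).1 + 0, (p j).2)) = p := by funext j; simp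
  rw [e0] at this
  refine ⟨_, fun j => ?_, this.trans hp⟩
  simpa using ht.2 j (Finset.mem_univ j)

lemma shE_inj : Function.Injective (fun α : ℕ × ℕ => (α.1 + 1, α.2)) := by
  rintro ⟨a, b⟩ ⟨c, d⟩ h; simpa using h

/-- horizontal shift by one -/
def shE : (ℕ × ℕ) ↪ (ℕ × ℕ) := ⟨fun α => (α.1 + 1, α.2), shE_inj⟩

lemma shE_apply (α : ℕ × ℕ) : shE α = (α.1 + 1, α.2) := rfl

/-- shift equivalence -/
noncomputable def shQ (D : Finset (ℕ × ℕ)) : D ≃ D.map shE :=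
  Equiv.ofBijective (fun α => ⟨shE α, Finset.mem_map_of_mem _ α.2⟩) (by
    constructor
    · intro x y h
      exact Subtype.ext (shE.injective (congrArg Subtype.val h))
    · rintro ⟨y, hy⟩
      obtain ⟨x, hx, rfl⟩ := Finset.mem_map.1 hy
      exact ⟨⟨x, hx⟩, rfl⟩)

lemma shQ_apply (D : Finset (ℕ × ℕ)) (α : D) : ((shQ D α : D.map shE) : ℕ × ℕ) = shE α := rfl

lemma phi_zero_shift {K : Type*} [Field K] (p : K × K) (b : ℕ) (α : ℕ × ℕ) :
    phi p (0, b) (shE α) = p.1 * phi p (0, b) α := by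
  simp [phi, shE_apply, pow_succ]; ring

lemma phi_succ_shift {K : Type*} [Field K] (p : K × K) (a b : ℕ) (α : ℕ × ℕ) :
    phi p (a + 1, b) (shE α) = p.1 * phi p (a + 1, b) α + ((a : K) + 1) * phi p (a, b) α := by
  obtain ⟨n, k⟩ := α
  simp only [phi, shE_apply, Nat.succ_descFactorial_succ]
  rw [Nat.descFactorial_succ n a]
  rw [← mul_assoc p.1, ← mul_assoc ((a:K)+1), ← add_mul]
  congr 1
  rw [Nat.add_sub_add_right]
  rcases lt_trichotomy n a with h | h | h
  · simp [Nat.descFactorial_eq_zero_iff_lt.2 h]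
  · subst h; simp
  · obtain ⟨j, rfl⟩ := Nat.exists_eq_add_of_lt h
    have e1 : a + j + 1 - a = j + 1 := by omega
    have e2 : a + j + 1 - (a + 1) = j := by omega
    rw [e1, e2]
    push_cast
    ring

lemma nul_shift {K : Type*} [Field K] {m : ℕ} {D : Finset (ℕ × ℕ)} {r : ℕ}
    (p : Fin r → K × K) (hp : ∀ j, (p j).1 ≠ 0) :
    Module.finrank K (LinearMap.ker (hcMat m (D.map shE) p).mulVecLin) ≤
    Module.finrank K (LinearMap.ker (hcMat m D p).mulVecLin) := by
  let L : (D.map shE → K) →ₗ[K] (D → K) := LinearMap.funLeft K K (shQ D)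
  refine LinearMap.finrank_le_finrank_of_injective
      (f := L.restrict (q := LinearMap.ker (hcMat m D p).mulVecLin) ?_) ?_
  · intro c hc
    rw [mem_ker_hc] at hc ⊢
    have key : ∀ j (a b : ℕ), a + b < m → ∑ α : D, phi (p j) (a, b) α * L c α = 0 := by
      intro j a
      induction a with
      | zero =>
        intro b hb
        have := hc j (0, b) hb
        rw [← (shQ D).sum_comp] at this
        simp only [shQ_apply, phi_zero_shift, mul_assoc, ← Finset.mul_sum] at this
        exact (mul_eq_zero.1 this).resolve_left (hp j)
      | succ a ih =>
        intro b hb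
        have := hc j (a + 1, b) hb
        rw [← (shQ D).sum_comp] at this
        simp only [shQ_apply, phi_succ_shift, add_mul, mul_assoc,
          Finset.sum_add_distrib, ← Finset.mul_sum] at this
        have h2 := ih b (by omega)
        change ∑ α : D, phi (p j) (a, b) α * c ((shQ D) α) = 0 at h2
        rw [h2, mul_zero, mul_zero, add_zero, add_zero] at this
        exact (mul_eq_zero.1 this).resolve_left (hp j)
    intro j β hβ
    exact key j β.1 β.2 hβ
  · have hL : Function.Injective L :=
      LinearMap.funLeft_injective_of_surjective _ _ _ (shQ D).surjective
    rintro ⟨x, hx⟩ ⟨y, hy⟩ h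
    exact Subtype.ext (hL (congrArg Subtype.val h))

lemma Reg.shift {K : Type*} [Field K] [CharZero K] {m : ℕ} {D D' : Finset (ℕ × ℕ)} {r e : ℕ}
    (h : Reg K m D r e) (c : ℕ) (hD' : ∀ α : ℕ × ℕ, α ∈ D' ↔ c ≤ α.1 ∧ (α.1 - c, α.2) ∈ D) :
    Reg K m D' r e := by
  induction c generalizing D' with
  | zero =>
    have : D' = D := by ext ⟨i, j⟩; simp [hD']
    rwa [this]
  | succ c ih =>
    let D'' : Finset (ℕ × ℕ) := D'.image (fun α => (α.1 - 1, α.2))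
    have hh : D' = D''.map shE := by
      ext ⟨i, j⟩
      simp only [Finset.mem_map, D'', Finset.mem_image, shE_apply]
      constructor
      · intro h
        have := ((hD' _).1 h).1
        refine ⟨(i - 1, j), ⟨(i, j), h, rfl⟩, ?_⟩
        simp only [Prod.mk.injEq, and_true]; omega
      · rintro ⟨x, ⟨⟨a, b⟩, hy, rfl⟩, hx⟩
        have h1 := ((hD' _).1 hy).1
        simp only [Prod.mk.injEq] at hx h1
        have : (i, j) = (a, b) := by
          simp only [Prod.mk.injEq]; omega
        rwa [this]
    have h2 : Reg K m D'' r e := by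
      apply ih
      rintro ⟨i, j⟩
      simp only [D'', Finset.mem_image]
      constructor
      · rintro ⟨⟨a, b⟩, hy, hx⟩
        obtain ⟨h1, h2⟩ := (hD' _).1 hy
        simp only [Prod.mk.injEq] at hx h1 h2 ⊢
        obtain ⟨rfl, rfl⟩ := hx
        refine ⟨by omega, ?_⟩
        have : a - 1 - c = a - (c + 1) := by omega
        rwa [this]
      · rintro ⟨h1, h2⟩
        refine ⟨(i + 1, j), (hD' _).2 ⟨by simpa using h1, ?_⟩, by simp⟩
        simpa using h2
    obtain ⟨p, hp, he⟩ := h2.nz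
    rw [hh]
    exact ⟨p, (nul_shift p hp).trans he⟩

/-- moments up to order `n` vanish -/
def Zm {K : Type*} [Field K] (D : Finset (ℕ × ℕ)) (n : ℕ) (c : ℕ × ℕ → K) : Prop :=
  ∀ a b : ℕ, a + b < n → ∑ α ∈ D,
    ((α.1.descFactorial a : ℕ) : K) * ((α.2.descFactorial b : ℕ) : K) * c α = 0

lemma cast_desc_succ (K : Type*) [Field K] (u k : ℕ) :
    ((u.descFactorial (k + 1) : ℕ) : K) = ((u : K) - k) * (u.descFactorial k : ℕ) := by
  rcases lt_or_ge u k with h | h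
  · rw [Nat.descFactorial_eq_zero_iff_lt.2 h, Nat.descFactorial_eq_zero_iff_lt.2 (by omega)]; simp
  · rw [Nat.descFactorial_succ]; push_cast [h]; ring

lemma Zm.affine {K : Type*} [Field K] {D : Finset (ℕ × ℕ)} {n : ℕ} {c : ℕ × ℕ → K}
    (h : Zm D (n + 1) c) (x y z : K) :
    Zm D n (fun α => (x + y * α.1 + z * α.2) * c α) := by
  intro a b hab
  have h0 := h a b (by omega)
  have h1 := h (a + 1) b (by omega)
  have h2 := h a (b + 1) (by omega)
  simp only [cast_desc_succ] at h1 h2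
  have : ∑ α ∈ D, ((α.1.descFactorial a : ℕ) : K) * ((α.2.descFactorial b : ℕ) : K) *
      ((x + y * α.1 + z * α.2) * c α) =
      (x + y * a + z * b) * ∑ α ∈ D, ((α.1.descFactorial a : ℕ) : K) *
        ((α.2.descFactorial b : ℕ) : K) * c α
      + y * ∑ α ∈ D, (((α.1 : K) - a) * (α.1.descFactorial a : ℕ)) *
        ((α.2.descFactorial b : ℕ) : K) * c α
      + z * ∑ α ∈ D, ((α.1.descFactorial a : ℕ) : K) *
        (((α.2 : K) - b) * (α.2.descFactorial b : ℕ)) * c α := by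
    simp only [Finset.mul_sum, ← Finset.sum_add_distrib]
    refine Finset.sum_congr rfl fun α _ => ?_
    ring
  rw [this, h0, h1, h2]
  simp

lemma Zm.desc {K : Type*} [Field K] {D : Finset (ℕ × ℕ)} {n k : ℕ} {c : ℕ × ℕ → K}
    (u : ℕ × ℕ → ℕ) (x y z : K) (hu : ∀ α ∈ D, (u α : K) = x + y * α.1 + z * α.2)
    (h : Zm D (n + k) c) :
    Zm D n (fun α => ((u α).descFactorial k : ℕ) * c α) := by
  induction k generalizing n with
  | zero => simpa using h
  | succ k ih =>
    have h1 := ih (n := n + 1) (by rwa [add_assoc, add_comm 1 k])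
    have h2 := h1.affine (x - k) y z
    intro a b hab
    rw [← h2 a b hab]
    refine Finset.sum_congr rfl fun α hα => ?_
    simp only [cast_desc_succ]
    rw [hu α hα]
    ring

lemma reg_tri {K : Type*} [Field K] [CharZero K] {m : ℕ} {D : Finset (ℕ × ℕ)}
    (u v w : ℕ × ℕ → ℕ) (x y z x' y' z' x'' y'' z'' : K)
    (hu : ∀ α ∈ D, (u α : K) = x + y * α.1 + z * α.2)
    (hv : ∀ α ∈ D, (v α : K) = x' + y' * α.1 + z' * α.2)
    (hw : ∀ α ∈ D, (w α : K) = x'' + y'' * α.1 + z'' * α.2)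
    (hs : ∀ α ∈ D, u α + v α + w α + 1 = m)
    (hinj : ∀ α ∈ D, ∀ β ∈ D, u α = u β → v α = v β → α = β) : Reg K m D 1 0 := by
  refine ⟨fun _ => (1, 1), ?_⟩
  rw [Nat.le_zero, Submodule.finrank_eq_zero, Submodule.eq_bot_iff]
  intro c hc
  rw [mem_ker_hc] at hc
  have hc := hc 0
  let c' : ℕ × ℕ → K := fun α => if h : α ∈ D then c ⟨α, h⟩ else 0
  have hZ : Zm D m c' := by
    intro a b hab
    have := hc (a, b) hab
    rw [← Finset.sum_coe_sort]
    rw [← this]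
    refine Finset.sum_congr rfl fun α _ => ?_
    simp [phi, c']
  ext ⟨α, hα⟩
  have hm := hs α hα
  have e : m = 1 + u α + v α + w α := by omega
  rw [e] at hZ
  have h3 := ((hZ.desc w _ _ _ hw).desc v _ _ _ hv).desc u _ _ _ hu
  have h4 := h3 0 0 (by omega)
  rw [Finset.sum_eq_single α] at h4
  · simpa [Nat.descFactorial_self, Nat.factorial_ne_zero, c', hα] using h4
  · intro β hβ hne
    have hb := hs β hβ
    have : u β < u α ∨ v β < v α ∨ w β < w α := by
      by_contra! hcon
      exact hne (hinj _ hβ _ hα (by omega) (by omega))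
    rcases this with h | h | h <;> simp [Nat.descFactorial_eq_zero_iff_lt.2 h]
  · exact fun h => absurd hα h

/-- slanted strip -/
def GG (c c' s s' : ℕ) : Finset (ℕ × ℕ) :=
  (Finset.range c' ×ˢ Finset.range s').filter
    (fun x => c ≤ x.1 ∧ s ≤ x.1 + x.2 ∧ x.1 + x.2 < s')

lemma mem_GG {c c' s s' : ℕ} {x : ℕ × ℕ} :
    x ∈ GG c c' s s' ↔ c ≤ x.1 ∧ x.1 < c' ∧ s ≤ x.1 + x.2 ∧ x.1 + x.2 < s' := by
  simp only [GG, Finset.mem_filter, Finset.mem_product, Finset.mem_range]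
  omega

lemma reg_block (K : Type*) [Field K] [CharZero K] (m c s : ℕ) (hm : 0 < m) (hs : c + m ≤ s) :
    Reg K m (GG c (c + m + 1) s (s + m)) (1 + 1) (0 + 0) := by
  refine Reg.cut (D₁ := (GG c (c + m + 1) s (s + m)).filter (fun x => s - c ≤ x.2))
    (D₂ := (GG c (c + m + 1) s (s + m)).filter (fun x => ¬ s - c ≤ x.2)) ?_ ?_ 0 1 (s - c - 1)
    ?_ ?_ (Finset.filter_union_filter_not_eq _ _).symm
  · refine reg_tri (fun x => x.1 - c) (fun x => x.2 - (s - c)) (fun x => s + m - 1 - x.1 - x.2)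
      (-(c : K)) 1 0 (-((s - c : ℕ) : K)) 0 1 ((s + m - 1 : ℕ) : K) (-1) (-1) ?_ ?_ ?_ ?_ ?_
    · rintro ⟨i, j⟩ h
      simp only [Finset.mem_filter, mem_GG] at h ⊢
      rw [Nat.cast_sub (by omega)]; ring
    · rintro ⟨i, j⟩ h
      simp only [Finset.mem_filter, mem_GG] at h ⊢
      rw [Nat.cast_sub (by omega)]; ring
    · rintro ⟨i, j⟩ h
      simp only [Finset.mem_filter, mem_GG] at h ⊢
      rw [Nat.cast_sub (by omega), Nat.cast_sub (by omega)]; ring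
    · rintro ⟨i, j⟩ h
      simp only [Finset.mem_filter, mem_GG] at h ⊢
      omega
    · rintro ⟨i, j⟩ h ⟨i', j'⟩ h' h1 h2
      simp only [Finset.mem_filter, mem_GG, Prod.mk.injEq] at h h' h1 h2 ⊢
      omega
  · refine reg_tri (fun x => c + m - x.1) (fun x => s - c - 1 - x.2) (fun x => x.1 + x.2 - s)
      ((c + m : ℕ) : K) (-1) 0 ((s - c - 1 : ℕ) : K) 0 (-1) (-(s : K)) 1 1 ?_ ?_ ?_ ?_ ?_
    · rintro ⟨i, j⟩ h
      simp only [Finset.mem_filter, mem_GG] at h ⊢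
      rw [Nat.cast_sub (by omega)]; ring
    · rintro ⟨i, j⟩ h
      simp only [Finset.mem_filter, mem_GG] at h ⊢
      rw [Nat.cast_sub (by omega)]; ring
    · rintro ⟨i, j⟩ h
      simp only [Finset.mem_filter, mem_GG] at h ⊢
      rw [Nat.cast_sub (by omega), Nat.cast_add]; ring
    · rintro ⟨i, j⟩ h
      simp only [Finset.mem_filter, mem_GG] at h ⊢
      omega
    · rintro ⟨i, j⟩ h ⟨i', j'⟩ h' h1 h2
      simp only [Finset.mem_filter, mem_GG, Prod.mk.injEq] at h h' h1 h2 ⊢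
      omega
  · rintro ⟨i, j⟩ h
    simp only [Finset.mem_filter, mem_GG] at h ⊢
    omega
  · rintro ⟨i, j⟩ h
    simp only [Finset.mem_filter, mem_GG] at h ⊢
    omega

lemma reg_empty (K : Type*) [Field K] (m : ℕ) : Reg K m ∅ 0 0 := by
  refine ⟨fun _ => (0, 0), ?_⟩
  refine (Submodule.finrank_le _).trans ?_
  simp

lemma reg_tall (K : Type*) [Field K] [CharZero K] (m c s n : ℕ) (hm : 0 < m) (hs : c + m ≤ s) :
    Reg K m (GG c (c + m + 1) s (s + n * m)) (2 * n) 0 := by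
  induction n with
  | zero =>
    have : GG c (c + m + 1) s (s + 0 * m) = ∅ := by
      ext x; simp only [mem_GG, Finset.notMem_empty, iff_false]; omega
    rw [this]; exact reg_empty K m
  | succ n ih =>
    have e : 2 * (n + 1) = 1 + 1 + 2 * n := by ring
    rw [e]
    have hb := reg_block K m c (s + n * m) hm (by omega)
    rcases Nat.eq_zero_or_pos (s + n * m) with h0 | h0
    · omega
    refine hb.cut ih 1 1 (s + n * m - 1) ?_ ?_ ?_
    · intro x hx; rw [mem_GG] at hx; omega
    · intro x hx; rw [mem_GG] at hx; omega
    · have : (n + 1) * m = n * m + m := by ring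
      ext x; simp only [mem_GG, Finset.mem_union, this]; omega

lemma reg_wide (K : Type*) [Field K] [CharZero K] (m s q : ℕ) (hm : 0 < m)
    (hs : q * (m + 1) ≤ s) :
    Reg K m (GG 0 (q * (m + 1)) s (s + m * (m + 1))) (q * (2 * (m + 1))) 0 := by
  induction q with
  | zero =>
    have : GG 0 (0 * (m + 1)) s (s + m * (m + 1)) = ∅ := by
      ext x; simp only [mem_GG, Finset.notMem_empty, iff_false]; omega
    rw [this, zero_mul]; exact reg_empty K m
  | succ q ih =>
    have e : (q + 1) * (2 * (m + 1)) = q * (2 * (m + 1)) + 2 * (m + 1) := by ring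
    have e2 : (q + 1) * (m + 1) = q * (m + 1) + m + 1 := by ring
    rw [e2] at hs
    rcases Nat.eq_zero_or_pos q with h0 | h0
    · subst h0
      have := reg_tall K m 0 s (m + 1) hm (by omega)
      rw [e2]
      simpa [mul_comm] using this
    have h0' : 0 < q * (m + 1) := by positivity
    have hb := reg_tall K m (q * (m + 1)) s (m + 1) hm (by omega)
    rw [e, e2, add_comm (q * (2 * (m + 1)))]
    refine hb.cut (ih (by omega)) 1 0 (q * (m + 1) - 1) ?_ ?_ ?_
    · intro x hx; rw [mem_GG] at hx; omega
    · intro x hx; rw [mem_GG] at hx; omega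
    · rw [mul_comm (m + 1) m]
      ext x; simp only [mem_GG, Finset.mem_union]; omega

lemma mem_eols {h k : ℕ} (hk : 1 ≤ k) (hh : 1 ≤ h) {x : ℕ × ℕ} :
    x ∈ eolsDiagram h k ↔ k - 1 ≤ x.1 + x.2 ∧ x.1 + x.2 < k - 1 + h := by
  simp only [eolsDiagram, Finset.mem_filter, Finset.mem_product, Finset.mem_range]
  omega

lemma card_eols {h k : ℕ} (hk : 1 ≤ k) (hh : 1 ≤ h) :
    (eolsDiagram h k).card * 2 = h * (2 * k + h - 1) := by
  have hu : triF (k - 1 + h) = eolsDiagram h k ∪ triF (k - 1) := by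
    ext x; simp only [Finset.mem_union, mem_eols hk hh, mem_triF]; omega
  have hd : Disjoint (eolsDiagram h k) (triF (k - 1)) := by
    rw [Finset.disjoint_left]; intro x; simp only [mem_eols hk hh, mem_triF]; omega
  have h1 := card_triF (k - 1 + h)
  have h2 := card_triF (k - 1)
  rw [hu, Finset.card_union_of_disjoint hd, add_mul, h2] at h1
  obtain ⟨k, rfl⟩ := Nat.exists_eq_add_of_le hk
  have e1 : 1 + k - 1 = k := by omega
  have e2 : 2 * (1 + k) + h - 1 = 2 * k + h + 1 := by omega
  rw [e1] at h1
  rw [e2]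
  nlinarith

theorem statement13 {K : Type*} [Field K] [CharZero K]
    (m d₀ : ℕ) (hm : 0 < m) (hd₀ : 0 < d₀)
    (hEoLS : ∀ k, 1 ≤ k → k ≤ m + 1 →
      nonSpecial K (eolsDiagram (m * (m + 1)) k)
        (fun _ : Fin (2 * k + m * (m + 1) - 1) => m))
    (hS : ∀ d r, d₀ ≤ d → d ≤ d₀ + m * (m + 1) → 1 ≤ r →
      vdimSys (fullDiagram d) (fun _ : Fin r => m) ≥ -(2 * (m : ℤ) ^ 2) →
      nonSpecial K (fullDiagram d) (fun _ : Fin r => m)) :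
    ∀ d r, d₀ ≤ d → nonSpecial K (fullDiagram d) (fun _ : Fin r => m) := by
  have hh : 1 ≤ m * (m + 1) := by nlinarith
  have hN := card_triF m
  have hNpos : 0 < (triF m).card := by omega
  intro d
  induction d using Nat.strong_induction_on with
  | _ d ih =>
  intro r hd
  by_cases hdh : d ≤ d₀ + m * (m + 1)
  · -- base range
    rcases Nat.eq_zero_or_pos r with rfl | hr
    · rw [nonSpecial_iff]
      refine ⟨fun _ => (0, 0), (Submodule.finrank_le _).trans ?_⟩
      simp
    by_cases hv : vdimSys (fullDiagram d) (fun _ : Fin r => m) ≥ -(2 * (m : ℤ) ^ 2)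
    · exact hS d r hd hdh hr hv
    · have hcard : 0 < (fullDiagram d).card := by
        apply Finset.card_pos.2
        refine ⟨(0, 0), ?_⟩
        rw [fullDiagram_eq, mem_triF]; simp
      rw [vdim_eq] at hv
      set C := (fullDiagram d).card with hC
      set N := (triF m).card with hNdef
      have hNm : N ≤ m * m := by nlinarith
      let r' := (C - 1) / N + 1
      have h1 := Nat.div_add_mod (C - 1) N
      have h2 := Nat.mod_lt (C - 1) hNpos
      set Q := (C - 1) / N with hQ
      have hr'1 : C ≤ r' * N := by
        have : r' * N = N * Q + N := by simp only [r']; ring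
        omega
      have hr'2 : r' * N < C + N := by
        have : r' * N = N * Q + N := by simp only [r']; ring
        omega
      have hvr : r' ≤ r := by
        by_contra hlt
        push Not at hlt
        have h3 : r * N ≤ r' * N := Nat.mul_le_mul_right _ hlt.le
        zify at h3 hr'2 hNm hcard
        apply hv
        nlinarith
      have hns := hS d r' hd hdh (Nat.le_add_left 1 _) (by
        rw [vdim_eq]
        zify at hr'2 hNm
        rw [← hC, ← hNdef]
        nlinarith)
      rw [nonSpecial_iff] at hns ⊢
      have hz := Nat.sub_eq_zero_of_le hr'1
      exact (hns.mono_pts hvr).mono_e (hz.le.trans (Nat.zero_le _))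
  · push Not at hdh
    have hN' := hN
    set h := m * (m + 1) with hhdef
    clear_value h
    set s := d - h + 1 with hs
    set q := s / (m + 1) with hq
    set k := s % (m + 1) + 1 with hk
    have hdm := Nat.div_add_mod s (m + 1)
    have hml : s % (m + 1) < m + 1 := Nat.mod_lt s (Nat.succ_pos m)
    rw [← hq] at hdm
    have hqs : q * (m + 1) + (k - 1) = s := by rw [hk, mul_comm q]; simpa using hdm
    have hk1 : 1 ≤ k := by omega
    have hE := hEoLS k hk1 (by omega)
    rw [nonSpecial_iff] at hE
    have hEc := card_eols hk1 hh
    have hE0 : Reg K m (eolsDiagram h k) (2 * k + h - 1) 0 := by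
      refine hE.mono_e ?_
      have : (eolsDiagram h k).card * 2 = (2 * k + h - 1) * (triF m).card * 2 := by
        rw [hEc, mul_assoc, hN', mul_comm]
      omega
    have hE1 : Reg K m (GG (q * (m + 1)) (d + 1) s (s + h)) (2 * k + h - 1) 0 := by
      refine hE0.shift (q * (m + 1)) ?_
      rintro ⟨i, j⟩
      rw [mem_eols hk1 hh, mem_GG]
      simp only
      omega
    have hW := reg_wide K m s q hm (by omega)
    rw [← hhdef] at hW
    -- the strip
    have hstrip : Reg K m (GG 0 (d + 1) s (s + h)) (2 * k + h - 1 + q * (2 * (m + 1))) 0 := by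
      rcases Nat.eq_zero_or_pos (q * (m + 1)) with h0 | h0
      · rw [h0] at hE1
        exact hE1.mono_pts (by omega)
      refine hE1.cut hW 1 0 (q * (m + 1) - 1) ?_ ?_ ?_
      · intro x hx; rw [mem_GG] at hx; omega
      · intro x hx; rw [mem_GG] at hx; omega
      · ext x; simp only [mem_GG, Finset.mem_union]; omega
    set R := 2 * k + h - 1 + q * (2 * (m + 1)) with hR
    have hcut : ∀ r', Reg K m (fullDiagram d) (R + r')
        ((fullDiagram (d - h)).card - r' * (triF m).card) := by
      intro r'
      have hI := ih (d - h) (by omega) r' (by omega)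
      rw [nonSpecial_iff] at hI
      have := hstrip.cut hI 1 1 (d - h) (D := fullDiagram d) ?_ ?_ ?_
      · simpa using this
      · intro x hx; rw [mem_GG] at hx; omega
      · intro x hx; rw [fullDiagram_eq, mem_triF] at hx; omega
      · ext x; simp only [mem_GG, Finset.mem_union, fullDiagram_eq, mem_triF]; omega
    have hcd : (fullDiagram d).card = (fullDiagram (d - h)).card + R * (triF m).card := by
      have c1 := card_triF (d + 1)
      have c2 := card_triF s
      rw [fullDiagram_eq, fullDiagram_eq]
      have hR' : R = 2 * s + h + 1 := by
        have : q * (2 * (m + 1)) = 2 * (q * (m + 1)) := by ring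
        omega
      have hds : d + 1 = s + h := by omega
      rw [← hs, hds, hR']
      rw [hds] at c1
      nlinarith
    rw [nonSpecial_iff]
    rcases le_total R r with hRr | hRr
    · obtain ⟨r', rfl⟩ := Nat.exists_eq_add_of_le hRr
      refine (hcut r').mono_e ?_
      rw [hcd, add_mul R r']
      omega
    · obtain ⟨j, hj⟩ := Nat.exists_eq_add_of_le hRr
      have h0 := hcut 0
      rw [add_zero, hj] at h0
      refine h0.drop.mono_e ?_
      rw [hcd, hj, add_mul]
      omega
end

section
/- Let m be a positive integer and let f ∈ K[X,Y] be a polynomial of total degree at most m−1 such that f(i,j) = 0 for every pair (i,j) ∈ ℕ² with i ≤ m−1, j ≤ m−1 and i+j ≥ m−1 (natural numbers regarded as elements of K via the natural map ℕ → K). Then f = 0. -/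
open MvPolynomial

lemma aux_dvd {K : Type*} [Field K] (a : K) (p : MvPolynomial (Fin 2) K) :
    (X 0 - C a) ∣ p - aeval (![C a, X 1] : Fin 2 → MvPolynomial (Fin 2) K) p := by
  induction p using MvPolynomial.induction_on with
  | C b => simp [MvPolynomial.algebraMap_eq]
  | add p q hp hq =>
    rw [map_add, add_sub_add_comm]
    exact dvd_add hp hq
  | mul_X p i hp =>
    rw [map_mul, aeval_X]
    obtain ⟨r, hr⟩ := hp
    rw [sub_eq_iff_eq_add] at hr
    generalize (aeval (![C a, X 1] : Fin 2 → MvPolynomial (Fin 2) K)) p = q at hr ⊢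
    fin_cases i
    · refine ⟨p + r * C a, ?_⟩
      simp
      linear_combination (C a) * hr
    · refine ⟨r * X 1, ?_⟩
      simp
      linear_combination (X 1) * hr

lemma aux_deg {K : Type*} [Field K] (a : K) (p : MvPolynomial (Fin 2) K) :
    (aeval (![Polynomial.C a, Polynomial.X] : Fin 2 → Polynomial K) p).natDegree
      ≤ p.totalDegree := by
  rw [aeval_def, eval₂_eq']
  refine Polynomial.natDegree_sum_le_of_forall_le _ _ ?_
  intro d hd
  have h1 := le_totalDegree hd
  rw [Finsupp.sum_fintype _ _ (by simp)] at h1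
  simp only [Fin.sum_univ_two, Fin.prod_univ_two] at h1 ⊢
  simp only [Matrix.cons_val_zero, Matrix.cons_val_one, Polynomial.algebraMap_eq,
    ← mul_assoc, ← map_pow, ← map_mul]
  refine (Polynomial.natDegree_C_mul_X_pow_le _ _).trans ?_
  omega

lemma aux_main {K : Type*} [Field K] [CharZero K] (n : ℕ) :
    ∀ (c : ℕ) (f : MvPolynomial (Fin 2) K), f.totalDegree ≤ n →
    (∀ i j : ℕ, i ≤ n → j ≤ n → n ≤ i + j →
      MvPolynomial.eval (fun v : Fin 2 => if v = 0 then (i : K) else ((c + j : ℕ) : K)) f = 0) →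
    f = 0 := by
  induction n with
  | zero =>
    intro c f hf hv
    rw [totalDegree_eq_zero_iff_eq_C.mp (Nat.le_zero.mp hf)] at hv ⊢
    have := hv 0 0 le_rfl le_rfl le_rfl
    rw [eval_C] at this
    rw [this, C_0]
  | succ n ih =>
    intro c f hf hv
    set a : K := ((n + 1 : ℕ) : K) with ha
    set P := aeval (![Polynomial.C a, Polynomial.X] : Fin 2 → Polynomial K) f with hP
    have hPe : ∀ y : K, P.eval y = eval (fun v : Fin 2 => if v = 0 then a else y) f := by
      intro y
      have : ((Polynomial.aeval y).comp
          (aeval (![Polynomial.C a, Polynomial.X] : Fin 2 → Polynomial K)))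
          = aeval (fun v : Fin 2 => if v = 0 then a else y) := by
        ext i
        fin_cases i <;> simp
      have := DFunLike.congr_fun this f
      simpa [Polynomial.aeval_def, Polynomial.eval₂_eq_eval_map, aeval_eq_eval] using this
    have hP0 : P = 0 := by
      refine Polynomial.eq_zero_of_natDegree_lt_card_of_eval_eq_zero P
        (f := fun j : Fin (n + 2) => ((c + j : ℕ) : K)) ?_ ?_ ?_
      · intro x y h
        have h' : c + (x : ℕ) = c + y := Nat.cast_injective h
        ext; omega
      · intro j
        rw [hPe]
        exact hv (n + 1) j le_rfl (by omega) (by omega)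
      · have := aux_deg a f
        rw [← hP] at this
        rw [Fintype.card_fin]
        omega
    have hz : aeval (![C a, X 1] : Fin 2 → MvPolynomial (Fin 2) K) f = 0 := by
      have : ((Polynomial.aeval (X 1 : MvPolynomial (Fin 2) K)).comp
          (aeval (![Polynomial.C a, Polynomial.X] : Fin 2 → Polynomial K)))
          = aeval (![C a, X 1] : Fin 2 → MvPolynomial (Fin 2) K) := by
        apply MvPolynomial.algHom_ext
        intro i
        fin_cases i <;> simp [MvPolynomial.algebraMap_eq]
      rw [← this, AlgHom.comp_apply, ← hP, hP0, map_zero]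
    obtain ⟨g, hg⟩ := aux_dvd a f
    rw [hz, sub_zero] at hg
    by_cases hg0 : g = 0
    · rw [hg, hg0, mul_zero]
    exfalso
    apply hg0
    have hXd : 1 ≤ (X 0 - C a : MvPolynomial (Fin 2) K).totalDegree := by
      have hc : coeff (Finsupp.single 0 1) (X 0 - C a : MvPolynomial (Fin 2) K) = 1 := by
        rw [coeff_sub, coeff_X, coeff_C]
        have : (0 : Fin 2 →₀ ℕ) ≠ Finsupp.single 0 1 := by
          intro h
          have := DFunLike.congr_fun h 0
          simp at this
        simp [this]
      have := le_totalDegree (p := (X 0 - C a : MvPolynomial (Fin 2) K))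
        (s := Finsupp.single 0 1) (by rw [mem_support_iff, hc]; exact one_ne_zero)
      simpa using this
    have hX0 : (X 0 - C a : MvPolynomial (Fin 2) K) ≠ 0 := by
      intro h; rw [h] at hXd; simp at hXd
    refine ih (c + 1) g ?_ ?_
    · rw [hg, totalDegree_mul_of_isDomain hX0 hg0] at hf
      omega
    · intro i j hi hj hij
      have := hv i (j + 1) (by omega) (by omega) (by omega)
      rw [hg, map_mul, mul_eq_zero] at this
      rcases this with h | h
      · exfalso
        simp [ha, sub_eq_zero] at h
        have : i = n + 1 := by exact_mod_cast h
        omega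
      · rw [show c + 1 + j = c + (j + 1) by ring]
        exact h

/-- Let `m ≥ 1` and let `f ∈ K[X,Y]` have total degree at most `m − 1`.
If `f(i, j) = 0` for every `(i, j) ∈ ℕ²` with `i ≤ m−1`, `j ≤ m−1` and `i + j ≥ m−1`
(natural numbers regarded as elements of `K`), then `f = 0`. -/
theorem statement16 {K : Type*} [Field K] [CharZero K]
    (m : ℕ) (hm : 0 < m) (f : MvPolynomial (Fin 2) K)
    (hdeg : f.totalDegree ≤ m - 1)
    (hvan : ∀ i j : ℕ, i ≤ m - 1 → j ≤ m - 1 → m - 1 ≤ i + j →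
      MvPolynomial.eval (fun v : Fin 2 => if v = 0 then (i : K) else (j : K)) f = 0) :
    f = 0 := by
  refine aux_main (m - 1) 0 f hdeg ?_
  intro i j hi hj hij
  rw [zero_add]
  exact hvan i j hi hj hij
end
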